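/- Let P ⊆ ℚ³ be a ℚ-Gorenstein canonical lattice polytope of index ι with vertex set {0, v₁, …, v_r} (all vᵢ ∈ ℤ³). Then, up to lattice equivalence, one of the following cases holds: (i) ι = 1 (and r, v₁,…,v_r arbitrary); (ii) r = 4, ι = 2, and the nonzero vertices are (1,0,2), (1+m,1,2), (1,2,2), (1−n,1,2) for some integers m, n ≥ 1; (iii) r = 3, ι ≥ 2, and the nonzero vertices are (1,n,ι), (0,n,ι), (1,n+m,ι) for some integers m, n ≥ 1 with gcd(n,ι) = 1; (iv) r = 3, ι = 2, and the nonzero vertices are (1,1,2), (0,1,2), (2,1+2m,2) for some integer m ≥ 2; (v) r = 3, ι = 2, and the nonzero vertices are (1,−2,2), (−1,−1,2), (2,1,2); (vi) r = 3, ι = 3, and the nonzero vertices are (1,−1,3), (0,−1,3), (2,2,3). -/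

import Mathlib

/-- The canonical embedding `ℤ³ → ℚ³`. -/
def castVec (p : Fin 3 → ℤ) : Fin 3 → ℚ := fun j => (p j : ℚ)

/-- The generating point set `{0, v₁, …, v_r}` of the polytope, in `ℚ³`. -/
def gens {r : ℕ} (v : Fin r → Fin 3 → ℤ) : Set (Fin 3 → ℚ) :=
  insert 0 (Set.range fun i => castVec (v i))

/-- The polytope `P = conv(0, v₁, …, v_r) ⊆ ℚ³`. -/
def hullP {r : ℕ} (v : Fin r → Fin 3 → ℤ) : Set (Fin 3 → ℚ) :=
  convexHull ℚ (gens v)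

/-- Lattice equivalence of subsets of `ℚ³`: one is the image of the other
under `v ↦ A v + w` with `A ∈ GL₃(ℤ)` and `w ∈ ℤ³`. -/
def LatticeEquiv3 (S S' : Set (Fin 3 → ℚ)) : Prop :=
  ∃ A : Matrix (Fin 3) (Fin 3) ℤ, (A.det = 1 ∨ A.det = -1) ∧
    ∃ w : Fin 3 → ℤ,
      S' = (fun p => (A.map (fun x : ℤ => (x : ℚ))).mulVec p + castVec w) '' S

/-- Division with remainder, rounding up. -/
theorem exists_ceil_div (b m : ℤ) (hb : 0 < b) : ∃ j : ℤ, (j - 1) * b < m ∧ m ≤ j * b := by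
  refine ⟨-((-m) / b), ?_, ?_⟩
  · have := Int.lt_ediv_add_one_mul_self (-m) hb
    linarith
  · have := Int.ediv_mul_le (-m) hb.ne'
    linarith

/-- Three Beatty-type floor sequences whose sum grows by one at every step cannot all have
slope at least `2 / n`. -/
theorem no_floor_partition (n a b c : ℤ) (hcb : c ≤ b) (hba : b ≤ a) (hc : 2 ≤ c) (han : a < n)
    (H : ∀ h, 0 < h → h < n → ∃ f g k : ℤ, f * n ≤ h * a ∧ h * a < (f + 1) * n ∧
      g * n ≤ h * b ∧ h * b < (g + 1) * n ∧ k * n ≤ h * c ∧ h * c < (k + 1) * n ∧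
      f + g + k = h - 1) : False := by
  have hn : 0 < n := by linarith
  have le_of {s t : ℤ} (h : s * n < (t + 1) * n) : s ≤ t := by
    have := lt_of_mul_lt_mul_right h hn.le
    linarith
  have hb : 0 ≤ b := by linarith
  have hc' : 0 ≤ c := by linarith
  have ha : 0 ≤ a := by linarith
  have mono {s t x : ℤ} (hx : 0 ≤ x) (h : s ≤ t) : s * x ≤ t * x :=
    mul_le_mul_of_nonneg_right h hx
  obtain ⟨h₁, hh1, hh1'⟩ := exists_ceil_div b n (by linarith)
  obtain ⟨h₂, hh2, hh2'⟩ := exists_ceil_div c n (by linarith)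
  have h1_two : 2 ≤ h₁ := by
    by_contra hlt
    have : h₁ ≤ 1 := by omega
    linarith [mono hb this]
  have h2_lt : h₂ < n := by
    by_contra hle
    have : n ≤ h₂ := by omega
    linarith [mono hc' this, mul_le_mul_of_nonneg_left hc (show 0 ≤ n - 1 by linarith)]
  have h1_le : h₁ ≤ h₂ := by
    by_contra hlt
    have : h₂ ≤ h₁ - 1 := by omega
    linarith [mono hc' this, mul_le_mul_of_nonneg_left hcb (show 0 ≤ h₁ - 1 by linarith)]
  -- the slope of `a` is determined by the first jump of `b`
  obtain ⟨f, g, k, hf, hf', hg, hg', hk, hk', hs⟩ := H (h₁ - 1) (by linarith) (by linarith)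
  have g0 : g ≤ 0 := le_of (by linarith)
  have k0 : k ≤ 0 := le_of (by
    linarith [mul_le_mul_of_nonneg_left hcb (show 0 ≤ h₁ - 1 by linarith)])
  have E1 : (h₁ - 2) * n ≤ (h₁ - 1) * a := by
    linarith [mono hn.le (show h₁ - 2 ≤ f by linarith)]
  clear f g k hf hf' hg hg' hk hk' hs g0 k0
  obtain ⟨f, g, k, hf, hf', hg, hg', hk, hk', hs⟩ := H h₁ (by linarith) (by linarith)
  have g1 : 1 ≤ g := le_of (by linarith)
  have f1 : h₁ - 2 ≤ f := le_of (by linarith)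
  have k0 : k ≤ 0 := by linarith
  have h1_lt : h₁ < h₂ := by
    by_contra hle
    have : h₁ = h₂ := by omega
    subst this
    linarith [mono hn.le k0]
  clear f g k hf hf' hg hg' hk hk' hs g1 f1 k0
  obtain ⟨f, k, z, hf, hf', hk, hk', hz, hz', hs⟩ := H (h₂ - 1) (by linarith) (by linarith)
  obtain ⟨f', k', z', hff, hff', hkk, hkk', hzz, hzz', hss⟩ := H h₂ (by linarith) (by linarith)
  have z0 : z ≤ 0 := le_of (by linarith)
  have z0' : 0 ≤ z := le_of (by
    have : 0 ≤ (h₂ - 1) * c := mul_nonneg (by linarith) (by linarith)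
    linarith)
  have z1 : 1 ≤ z' := le_of (by linarith)
  have ff' : f ≤ f' := le_of (by linarith)
  have kk' : k ≤ k' := le_of (by linarith)
  obtain rfl : z = 0 := by linarith
  obtain rfl : z' = 1 := by linarith
  obtain rfl : f = f' := by linarith
  obtain rfl : k = k' := by linarith
  have k1 : 1 ≤ k := le_of (by
    have : h₁ * b ≤ (h₂ - 1) * b := mul_le_mul_of_nonneg_right (by linarith) (by linarith)
    linarith)
  have kb : k + 1 ≤ b - 1 := by
    by_contra hlt
    have h0 : b - 1 ≤ k := by omega
    have h3 : (b - 1) * n ≤ (h₂ - 1) * b := (mul_le_mul_of_nonneg_right h0 hn.le).trans hk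
    have h4 : (h₂ - 1) * 2 ≤ (h₂ - 1) * c := mul_le_mul_of_nonneg_left hc (by linarith)
    have h5 : (h₂ - 1) * 2 * b ≤ (n - 1) * b :=
      mul_le_mul_of_nonneg_right (by linarith) (by linarith)
    have h6 : 2 * n ≤ b * n := mul_le_mul_of_nonneg_right (by linarith) hn.le
    linarith
  obtain ⟨j₁, hj1, hj1'⟩ := exists_ceil_div b (k * n) (by linarith)
  obtain ⟨j₂, hj2, hj2'⟩ := exists_ceil_div b ((k + 1) * n) (by linarith)
  have j1_le : j₁ ≤ h₂ - 1 := by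
    by_contra hlt
    have : h₂ - 1 ≤ j₁ - 1 := by omega
    linarith [mono hb this]
  have j1_two : 2 ≤ j₁ := by
    by_contra hlt
    have : j₁ ≤ 1 := by omega
    linarith [mono hb this, mono hn.le k1]
  have j2_gt : h₂ < j₂ := by
    by_contra hle
    have : j₂ ≤ h₂ := by omega
    linarith [mono hb this]
  have j2_lt : j₂ < n := by
    by_contra hle
    have : n - 1 ≤ j₂ - 1 := by omega
    linarith [mono hb this, mono hn.le kb]
  have gap (t : ℤ) (ht : 0 ≤ t) (h : (t + 1) * a < t * n) : h₁ - 1 ≤ t := by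
    by_contra hlt
    have : t + 1 ≤ h₁ - 1 := by omega
    linarith [mono (show 0 ≤ n - a by linarith) this]
  have gap1 : h₁ - 1 ≤ h₂ - j₁ := by
    apply gap _ (by linarith)
    obtain ⟨p, q, s, hp, hp', hq, hq', hs', hs'', hsum⟩ := H (j₁ - 1) (by linarith) (by linarith)
    have : q + 1 ≤ k := by
      have : q < k := lt_of_mul_lt_mul_right (by linarith) hn.le
      linarith
    have : s ≤ 0 := le_of (by linarith [mono hc' (show j₁ - 1 ≤ h₂ - 1 by linarith)])
    have : j₁ - 1 - k ≤ p := by linarith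
    have hf2 : f = h₂ - 2 - k := by linarith
    rw [hf2] at hff'
    linarith [mono hn.le this]
  have gap2 : h₁ - 1 ≤ j₂ - h₂ := by
    apply gap _ (by linarith)
    obtain ⟨p, q, s, hp, hp', hq, hq', hs', hs'', hsum⟩ := H j₂ (by linarith) (by linarith)
    have : k + 1 ≤ q := le_of (by linarith)
    have : 1 ≤ s := le_of (by linarith [mono hc' j2_gt.le])
    have : p ≤ j₂ - k - 3 := by linarith
    have hf2 : f = h₂ - 2 - k := by linarith
    rw [hf2] at hf
    linarith [mono hn.le this]
  have gap3 : j₂ - 1 - j₁ < h₁ := by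
    by_contra hle
    have : h₁ ≤ j₂ - 1 - j₁ := by omega
    linarith [mono hb this]
  obtain rfl : h₁ = 2 := by linarith
  obtain ⟨p, q, s, hp, hp', hq, hq', hs', hs'', hsum⟩ := H 2 (by linarith) (by linarith)
  have : 1 ≤ p := le_of (by linarith)
  have : 1 ≤ q := le_of (by linarith)
  have : 0 ≤ s := le_of (by linarith)
  linarith

/-- The terminal lemma in dimension three, in arithmetic form. -/
theorem emod_eq_one_of_sum_emod (n A B C : ℤ) (hn : 2 ≤ n)
    (H : ∀ h, 0 < h → h < n → (h * A) % n + (h * B) % n + (h * C) % n = h + n) :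
    A % n = 1 ∨ B % n = 1 ∨ C % n = 1 := by
  have hn0 : 0 < n := by linarith
  have key (a b c : ℤ) (hc0 : 0 ≤ c) (hcb : c ≤ b) (hba : b ≤ a) (han : a < n)
      (H : ∀ h, 0 < h → h < n → (h * a) % n + (h * b) % n + (h * c) % n = h + n) : c = 1 := by
    have h1 := H 1 (by linarith) (by linarith)
    rw [one_mul, one_mul, one_mul, Int.emod_eq_of_lt (by linarith) (by linarith),
      Int.emod_eq_of_lt (by linarith) (by linarith),
      Int.emod_eq_of_lt (by linarith) (by linarith)] at h1
    rcases lt_trichotomy c 1 with hlt | heq | hgt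
    · obtain rfl : c = 0 := by linarith
      have h2 := H (n - 1) (by linarith) (by linarith)
      have e (z : ℤ) (hz : 0 < z) (hz' : z < n) : ((n - 1) * z) % n = n - z := by
        have : (n - 1) * z = (n - z) + n * (z - 1) := by ring
        rw [this, Int.add_mul_emod_self_left, Int.emod_eq_of_lt (by linarith) (by linarith)]
      rw [e a (by linarith) han, e b (by linarith) (by linarith), mul_zero, Int.zero_emod] at h2
      linarith
    · exact heq
    · refine (no_floor_partition n a b c hcb hba hgt han fun h hh hh' => ?_).elim
      have h2 := H h hh hh'
      refine ⟨h * a / n, h * b / n, h * c / n, Int.ediv_mul_le _ hn0.ne',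
        Int.lt_ediv_add_one_mul_self _ hn0, Int.ediv_mul_le _ hn0.ne',
        Int.lt_ediv_add_one_mul_self _ hn0, Int.ediv_mul_le _ hn0.ne',
        Int.lt_ediv_add_one_mul_self _ hn0, ?_⟩
      have ea := Int.emod_add_mul_ediv (h * a) n
      have eb := Int.emod_add_mul_ediv (h * b) n
      have ec := Int.emod_add_mul_ediv (h * c) n
      have : n * (h * a / n + h * b / n + h * c / n) = n * (h - 1) := by
        linear_combination ea + eb + ec - h2 + h * h1
      exact mul_left_cancel₀ hn0.ne' this
  have H' : ∀ h, 0 < h → h < n →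
      (h * (A % n)) % n + (h * (B % n)) % n + (h * (C % n)) % n = h + n := by
    intro h hh hh'
    simpa [Int.mul_emod] using H h hh hh'
  have a0 := Int.emod_nonneg A hn0.ne'
  have b0 := Int.emod_nonneg B hn0.ne'
  have c0 := Int.emod_nonneg C hn0.ne'
  have an := Int.emod_lt_of_pos A hn0
  have bn := Int.emod_lt_of_pos B hn0
  have cn := Int.emod_lt_of_pos C hn0
  generalize A % n = a at *
  generalize B % n = b at *
  generalize C % n = c at *
  rcases le_total a b with h1 | h1 <;> rcases le_total b c with h2 | h2 <;>
    rcases le_total a c with h3 | h3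
  · exact Or.inl (key c b a a0 h1 h2 cn fun h x y => by linarith [H' h x y])
  · exact Or.inl (key c b a a0 h1 h2 cn fun h x y => by linarith [H' h x y])
  · exact Or.inl (key b c a a0 h3 h2 bn fun h x y => by linarith [H' h x y])
  · exact Or.inr (Or.inr (key b a c c0 h3 h1 bn fun h x y => by linarith [H' h x y]))
  · exact Or.inr (Or.inl (key c a b b0 h1 h3 cn fun h x y => by linarith [H' h x y]))
  · exact Or.inr (Or.inl (key a c b b0 h2 h3 an fun h x y => by linarith [H' h x y]))
  · exact Or.inr (Or.inr (key a b c c0 h2 h1 an fun h x y => by linarith [H' h x y]))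
  · exact Or.inr (Or.inr (key a b c c0 h2 h1 an fun h x y => by linarith [H' h x y]))

/-- The set `S` of lattice points and the set `V` of vertices of a lattice polygon whose points are
recorded relative to the lattice point `(x, y)`. The polygon is placed at height `n`, and no lattice
point of the cone from the origin over it has height strictly between `0` and `n`. -/
structure IsConf (n x y : ℤ) (S V : ℤ → ℤ → Prop) : Prop where
  sub : ∀ i j, V i j → S i j
  closed : ∀ a₁ a₂ b₁ b₂ c₁ c₂ l m k p q : ℤ, S a₁ a₂ → S b₁ b₂ → S c₁ c₂ →
    0 ≤ l → 0 ≤ m → 0 ≤ k → 0 < l + m + k →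
    l * a₁ + m * b₁ + k * c₁ = (l + m + k) * p →
    l * a₂ + m * b₂ + k * c₂ = (l + m + k) * q → S p q
  supp : ∀ g₁ g₂ c : ℤ, (∀ i j, V i j → c ≤ g₁ * i + g₂ * j) → ∀ i j, S i j → c ≤ g₁ * i + g₂ * j
  ext : ∀ a₁ a₂ b₁ b₂ c₁ c₂ l m k p q : ℤ, S a₁ a₂ → S b₁ b₂ → S c₁ c₂ →
    0 ≤ l → 0 ≤ m → 0 ≤ k → 0 < l + m + k →
    l * a₁ + m * b₁ + k * c₁ = (l + m + k) * p →
    l * a₂ + m * b₂ + k * c₂ = (l + m + k) * q → V p q →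
    (a₁ = p ∧ a₂ = q) ∨ (b₁ = p ∧ b₂ = q) ∨ (c₁ = p ∧ c₂ = q)
  nondeg : ∀ g₁ g₂ c : ℤ, (g₁ ≠ 0 ∨ g₂ ≠ 0) → ∃ i j, S i j ∧ g₁ * i + g₂ * j ≠ c
  bdd : ∀ g₁ g₂ : ℤ, ∃ B, ∀ i j, S i j → g₁ * i + g₂ * j ≤ B
  canon : ∀ h a₁ a₂ b₁ b₂ c₁ c₂ l m k p q : ℤ, 0 < h → h < n → S a₁ a₂ → S b₁ b₂ → S c₁ c₂ →
    0 ≤ l → 0 ≤ m → 0 ≤ k → 0 < l + m + k →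
    h * (l * (x + a₁) + m * (x + b₁) + k * (x + c₁)) = n * (l + m + k) * p →
    h * (l * (y + a₂) + m * (y + b₂) + k * (y + c₂)) = n * (l + m + k) * q → False

/-- The preimage of a planar relation under the affine map `(i, j) ↦ (a i + b j + t, c i + d j + s)`. -/
def pull (a b c d t s : ℤ) (S : ℤ → ℤ → Prop) : ℤ → ℤ → Prop :=
  fun i j => S (a * i + b * j + t) (c * i + d * j + s)

theorem pull_mk {a b c d t s i j p q : ℤ} {S : ℤ → ℤ → Prop} (h : S p q)
    (hp : p = a * i + b * j + t) (hq : q = c * i + d * j + s) : pull a b c d t s S i j := by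
  subst hp hq
  exact h

theorem of_pull {a b c d t s i j p q : ℤ} {S : ℤ → ℤ → Prop} (h : pull a b c d t s S i j)
    (hp : a * i + b * j + t = p) (hq : c * i + d * j + s = q) : S p q := by
  subst hp hq
  exact h

theorem eq_of_eq_of_eq {S : ℤ → ℤ → Prop} {p q p' q' : ℤ} (h : S p q) (hp : p = p') (hq : q = q') :
    S p' q' := by
  subst hp hq
  exact h

theorem eq_of_unimodular {a b c d D u v : ℤ} (hD : a * d - b * c = D) (hDD : D * D = 1)
    (h₁ : a * u + b * v = 0) (h₂ : c * u + d * v = 0) : u = 0 ∧ v = 0 := by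
  constructor
  · linear_combination (D * d) * h₁ - (D * b) * h₂ - D * u * hD - u * hDD
  · linear_combination (D * a) * h₂ - (D * c) * h₁ - D * v * hD - v * hDD

theorem IsConf.pull {n x y : ℤ} {S V : ℤ → ℤ → Prop} (h : IsConf n x y S V)
    (a b c d t s : ℤ) {D : ℤ} (hD : a * d - b * c = D) (hDD : D * D = 1) :
    IsConf n (D * (d * (x + t) - b * (y + s))) (D * (a * (y + s) - c * (x + t)))
      (pull a b c d t s S) (pull a b c d t s V) where
  sub i j hv := h.sub _ _ hv
  closed a₁ a₂ b₁ b₂ c₁ c₂ l m k p q ha hb hc hl hm hk hpos e₁ e₂ :=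
    h.closed _ _ _ _ _ _ l m k _ _ ha hb hc hl hm hk hpos
      (by linear_combination a * e₁ + b * e₂) (by linear_combination c * e₁ + d * e₂)
  supp g₁ g₂ e hV i j hS := by
    have key := h.supp (D * (g₁ * d - g₂ * c)) (D * (g₂ * a - g₁ * b))
      (e + D * (g₁ * d - g₂ * c) * t + D * (g₂ * a - g₁ * b) * s) (fun i' j' hv => by
        have := hV (D * (d * (i' - t) - b * (j' - s))) (D * (a * (j' - s) - c * (i' - t)))
          (pull_mk hv
            (by linear_combination (t - i') * hDD - D * (i' - t) * hD)
            (by linear_combination (s - j') * hDD - D * (j' - s) * hD))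
        linarith) _ _ hS
    have e₁ : D * (g₁ * d - g₂ * c) * (a * i + b * j + t) +
        D * (g₂ * a - g₁ * b) * (c * i + d * j + s) = g₁ * i + g₂ * j +
        D * (g₁ * d - g₂ * c) * t + D * (g₂ * a - g₁ * b) * s := by
      linear_combination (g₁ * i + g₂ * j) * hDD + D * (g₁ * i + g₂ * j) * hD
    linarith
  ext a₁ a₂ b₁ b₂ c₁ c₂ l m k p q ha hb hc hl hm hk hpos e₁ e₂ hv := by
    have inj (u v : ℤ) (hu : a * u + b * v + t = a * p + b * q + t)
        (hv : c * u + d * v + s = c * p + d * q + s) : u = p ∧ v = q := by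
      obtain ⟨h₁, h₂⟩ := eq_of_unimodular (u := u - p) (v := v - q) hD hDD
        (by linear_combination hu) (by linear_combination hv)
      exact ⟨by linarith, by linarith⟩
    rcases h.ext _ _ _ _ _ _ l m k _ _ ha hb hc hl hm hk hpos
      (by linear_combination a * e₁ + b * e₂) (by linear_combination c * e₁ + d * e₂) hv with
      ⟨h₁, h₂⟩ | ⟨h₁, h₂⟩ | ⟨h₁, h₂⟩
    · exact Or.inl (inj _ _ h₁ h₂)
    · exact Or.inr (Or.inl (inj _ _ h₁ h₂))
    · exact Or.inr (Or.inr (inj _ _ h₁ h₂))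
  nondeg g₁ g₂ e hg := by
    have hg' : D * (g₁ * d - g₂ * c) ≠ 0 ∨ D * (g₂ * a - g₁ * b) ≠ 0 := by
      by_contra hcon
      push Not at hcon
      obtain ⟨h₁, h₂⟩ := hcon
      have hz₁ : g₁ = 0 := by
        linear_combination a * h₁ + c * h₂ - g₁ * hDD - D * g₁ * hD
      have hz₂ : g₂ = 0 := by
        linear_combination b * h₁ + d * h₂ - g₂ * hDD - D * g₂ * hD
      tauto
    obtain ⟨i, j, hS, hne⟩ := h.nondeg (D * (g₁ * d - g₂ * c)) (D * (g₂ * a - g₁ * b))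
      (e + D * (g₁ * d - g₂ * c) * t + D * (g₂ * a - g₁ * b) * s) hg'
    refine ⟨D * (d * (i - t) - b * (j - s)), D * (a * (j - s) - c * (i - t)),
      pull_mk hS (by linear_combination (t - i) * hDD - D * (i - t) * hD)
        (by linear_combination (s - j) * hDD - D * (j - s) * hD), fun heq => hne ?_⟩
    linear_combination heq
  bdd g₁ g₂ := by
    obtain ⟨B, hB⟩ := h.bdd (D * (g₁ * d - g₂ * c)) (D * (g₂ * a - g₁ * b))
    refine ⟨B - D * (g₁ * d - g₂ * c) * t - D * (g₂ * a - g₁ * b) * s, fun i j hS => ?_⟩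
    have := hB _ _ hS
    have e₁ : D * (g₁ * d - g₂ * c) * (a * i + b * j + t) +
        D * (g₂ * a - g₁ * b) * (c * i + d * j + s) = g₁ * i + g₂ * j +
        D * (g₁ * d - g₂ * c) * t + D * (g₂ * a - g₁ * b) * s := by
      linear_combination (g₁ * i + g₂ * j) * hDD + D * (g₁ * i + g₂ * j) * hD
    linarith
  canon r a₁ a₂ b₁ b₂ c₁ c₂ l m k p q hr hrn ha hb hc hl hm hk hpos e₁ e₂ := by
    refine h.canon r _ _ _ _ _ _ l m k (a * p + b * q) (c * p + d * q) hr hrn ha hb hc hl hm hk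
      hpos ?_ ?_
    · linear_combination a * e₁ + b * e₂ - r * (l + m + k) * (x + t) * (D * hD + hDD)
    · linear_combination c * e₁ + d * e₂ - r * (l + m + k) * (y + s) * (D * hD + hDD)

/-- An affine unimodular map, with translation part divisible by `n`, carries the points of `V`
onto `E`. -/
def Img (n x y : ℤ) (V : ℤ → ℤ → Prop) (E : Set (ℤ × ℤ)) : Prop :=
  ∃ a b c d k l : ℤ, (a * d - b * c = 1 ∨ a * d - b * c = -1) ∧
    ∀ p q, (p, q) ∈ E ↔ ∃ i j, V i j ∧ p = a * (x + i) + b * (y + j) + n * k ∧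
      q = c * (x + i) + d * (y + j) + n * l

theorem Img.of_pull {n x y : ℤ} {V : ℤ → ℤ → Prop} {E : Set (ℤ × ℤ)}
    (a b c d t s : ℤ) {D : ℤ} (hD : a * d - b * c = D) (hDD : D * D = 1)
    (h : Img n (D * (d * (x + t) - b * (y + s))) (D * (a * (y + s) - c * (x + t)))
      (pull a b c d t s V) E) : Img n x y V E := by
  obtain ⟨a', b', c', d', k, l, hdet, hE⟩ := h
  refine ⟨D * (a' * d - b' * c), D * (b' * a - a' * b), D * (c' * d - d' * c),
    D * (d' * a - c' * b), k, l, ?_, fun p q => ?_⟩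
  · have e : D * (a' * d - b' * c) * (D * (d' * a - c' * b)) -
        D * (b' * a - a' * b) * (D * (c' * d - d' * c)) = (a' * d' - b' * c') * D := by
      linear_combination (a' * d' - b' * c') * (a * d - b * c) * hDD + (a' * d' - b' * c') * hD
    rw [e]
    have hD' : D = 1 ∨ D = -1 := by
      rcases Int.isUnit_iff.1 (IsUnit.of_mul_eq_one D hDD) with h | h <;> tauto
    rcases hdet with h₁ | h₁ <;> rcases hD' with h₂ | h₂ <;> rw [h₁, h₂] <;> norm_num
  · rw [hE]
    constructor
    · rintro ⟨i, j, hv, rfl, rfl⟩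
      refine ⟨_, _, hv, ?_, ?_⟩
      · linear_combination (-a' * i - b' * j) * (D * hD + hDD)
      · linear_combination (-c' * i - d' * j) * (D * hD + hDD)
    · rintro ⟨i, j, hv, rfl, rfl⟩
      refine ⟨D * (d * (i - t) - b * (j - s)), D * (a * (j - s) - c * (i - t)),
        pull_mk hv (by linear_combination (t - i) * hDD - D * (i - t) * hD)
          (by linear_combination (s - j) * hDD - D * (j - s) * hD), ?_, ?_⟩
      · ring
      · ring

/-- The vertex sets of the polygons in the classification. -/
def IsModel (n : ℤ) (E : Set (ℤ × ℤ)) : Prop :=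
  (n = 2 ∧ ∃ m k : ℤ, 1 ≤ m ∧ 1 ≤ k ∧ E = {(1, 0), (1 + m, 1), (1, 2), (1 - k, 1)}) ∨
  (∃ m k : ℤ, 1 ≤ m ∧ 1 ≤ k ∧ Int.gcd k n = 1 ∧ E = {(1, k), (0, k), (1, k + m)}) ∨
  (n = 2 ∧ ∃ m : ℤ, 2 ≤ m ∧ E = {(1, 1), (0, 1), (2, 1 + 2 * m)}) ∨
  (n = 2 ∧ E = {(1, -2), (-1, -1), (2, 1)}) ∨
  (n = 3 ∧ E = {(1, -1), (0, -1), (2, 2)})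

/-- The polygon with vertices `V` is equivalent to one in the classification. -/
def Classified (n x y : ℤ) (V : ℤ → ℤ → Prop) : Prop :=
  ∃ E, IsModel n E ∧ Img n x y V E

theorem Classified.of_pull {n x y : ℤ} {V : ℤ → ℤ → Prop}
    (a b c d t s : ℤ) {D : ℤ} (hD : a * d - b * c = D) (hDD : D * D = 1)
    (h : Classified n (D * (d * (x + t) - b * (y + s))) (D * (a * (y + s) - c * (x + t)))
      (pull a b c d t s V)) : Classified n x y V := by
  obtain ⟨E, hE, hI⟩ := h
  exact ⟨E, hE, hI.of_pull a b c d t s hD hDD⟩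

namespace IsConf

variable {n x y : ℤ} {S V : ℤ → ℤ → Prop}

theorem seg (h : IsConf n x y S V) {a₁ a₂ b₁ b₂ l m p q : ℤ} (ha : S a₁ a₂) (hb : S b₁ b₂)
    (hl : 0 ≤ l) (hm : 0 ≤ m) (hpos : 0 < l + m) (e₁ : l * a₁ + m * b₁ = (l + m) * p)
    (e₂ : l * a₂ + m * b₂ = (l + m) * q) : S p q :=
  h.closed a₁ a₂ b₁ b₂ a₁ a₂ l m 0 p q ha hb ha hl hm le_rfl (by linarith)
    (by linear_combination e₁) (by linear_combination e₂)

theorem eq_one_of_dvd (h : IsConf n x y S V) (hn : 0 < n) {i j g : ℤ} (hS : S i j) (hg : 0 < g)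
    (h₁ : g ∣ x + i) (h₂ : g ∣ y + j) (h₃ : g ∣ n) : g = 1 := by
  by_contra hne
  obtain ⟨p, hp⟩ := h₁
  obtain ⟨q, hq⟩ := h₂
  obtain ⟨r, hr⟩ := h₃
  have hr0 : 0 < r := by
    by_contra hle
    nlinarith
  refine h.canon r i j i j i j 1 0 0 p q hr0 (by nlinarith [show 2 ≤ g by omega]) hS hS hS
    (by norm_num) le_rfl le_rfl (by norm_num) ?_ ?_
  · linear_combination r * hp - p * hr
  · linear_combination r * hq - q * hr

theorem not_dvd (h : IsConf n x y S V) (hn : 2 ≤ n) {i j : ℤ} (hS : S i j) (h₁ : n ∣ x + i)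
    (h₂ : n ∣ y + j) : False := by
  have := h.eq_one_of_dvd (by linarith) hS (by linarith) h₁ h₂ dvd_rfl
  linarith

theorem eq_of_prime (h : IsConf n x y S V) (hn : 2 ≤ n) {p : ℤ} (hp : Prime p) (hp0 : 0 < p)
    {i j : ℤ} (hS : S i j) (h₁ : n ∣ p * (x + i)) (h₂ : n ∣ p * (y + j)) : n = p := by
  by_cases hpn : p ∣ n
  · obtain ⟨m, rfl⟩ := hpn
    have hm : 0 < m := by
      by_contra hle
      nlinarith
    have := h.eq_one_of_dvd (by linarith) hS hm (Int.dvd_of_mul_dvd_mul_left hp0.ne' h₁)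
      (Int.dvd_of_mul_dvd_mul_left hp0.ne' h₂) (dvd_mul_left _ _)
    rw [this, mul_one]
  · have hco : IsCoprime n p := ((Prime.coprime_iff_not_dvd hp).2 hpn).symm
    exact (h.not_dvd hn hS (hco.dvd_of_dvd_mul_left h₁) (hco.dvd_of_dvd_mul_left h₂)).elim

theorem white (h : IsConf n x y S V) (hn : 2 ≤ n) (h00 : S 0 0) (h10 : S 1 0) (h01 : S 0 1) :
    n ∣ x + y ∨ n ∣ x + 1 ∨ n ∣ y + 1 := by
  have hn0 : 0 < n := by linarith
  have key := emod_eq_one_of_sum_emod n (1 + x + y) (-x) (-y) hn fun r hr hrn => by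
    have ea := Int.emod_add_mul_ediv (r * (1 + x + y)) n
    have eb := Int.emod_add_mul_ediv (r * -x) n
    have ec := Int.emod_add_mul_ediv (r * -y) n
    have a0 := Int.emod_nonneg (r * (1 + x + y)) hn0.ne'
    have b0 := Int.emod_nonneg (r * -x) hn0.ne'
    have c0 := Int.emod_nonneg (r * -y) hn0.ne'
    have an := Int.emod_lt_of_pos (r * (1 + x + y)) hn0
    have bn := Int.emod_lt_of_pos (r * -x) hn0
    have cn := Int.emod_lt_of_pos (r * -y) hn0
    generalize (r * (1 + x + y)) % n = α at *
    generalize (r * -x) % n = β at *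
    generalize (r * -y) % n = γ at *
    generalize (r * (1 + x + y)) / n = u at *
    generalize (r * -x) / n = v at *
    generalize (r * -y) / n = w at *
    have hsum : α + β + γ = r + n * (-u - v - w) := by linear_combination ea + eb + ec
    generalize ht : -u - v - w = t at hsum
    have ht0 : 0 ≤ t := by
      by_contra hlt
      nlinarith
    have ht2 : t ≤ 2 := by
      by_contra hlt
      nlinarith
    have ht02 : t = 0 ∨ t = 1 ∨ t = 2 := by omega
    rcases ht02 with rfl | rfl | rfl
    · refine (h.canon r 0 0 1 0 0 1 α β γ (-v) (-w) hr hrn h00 h10 h01 a0 b0 c0 (by linarith)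
        ?_ ?_).elim
      · linear_combination (r * x + n * v) * hsum + r * eb
      · linear_combination (r * y + n * w) * hsum + r * ec
    · linarith
    · refine (h.canon (n - r) 0 0 1 0 0 1 (n - α) (n - β) (n - γ) (x + 1 + v) (y + 1 + w)
        (by linarith) (by linarith) h00 h10 h01 (by linarith) (by linarith) (by linarith)
        (by linarith) ?_ ?_).elim
      · linear_combination (-x * (n - r) + n * (x + 1 + v)) * hsum - (n - r) * eb
      · linear_combination (-y * (n - r) + n * (y + 1 + w)) * hsum - (n - r) * ec
  have dvd_of {z : ℤ} (hz : z % n = 1) : n ∣ z - 1 := by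
    have := Int.emod_add_mul_ediv z n
    exact ⟨z / n, by linarith⟩
  rcases key with h1 | h1 | h1
  · left
    have := dvd_of h1
    rwa [show 1 + x + y - 1 = x + y by ring] at this
  · right; left
    rw [← dvd_neg]
    have := dvd_of h1
    rwa [show -x - 1 = -(x + 1) by ring] at this
  · right; right
    rw [← dvd_neg]
    have := dvd_of h1
    rwa [show -y - 1 = -(y + 1) by ring] at this

/-- `white` for an arbitrary unimodular triangle. -/
theorem white_triangle (h : IsConf n x y S V) (hn : 2 ≤ n) (p q u₁ u₂ v₁ v₂ : ℤ) {D : ℤ}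
    (hD : u₁ * v₂ - v₁ * u₂ = D) (hDD : D * D = 1) (h0 : S p q) (hu : S (p + u₁) (q + u₂))
    (hv : S (p + v₁) (q + v₂)) :
    n ∣ D * (v₂ * (x + p) - v₁ * (y + q)) + D * (u₁ * (y + q) - u₂ * (x + p)) ∨
      n ∣ D * (v₂ * (x + p) - v₁ * (y + q)) + 1 ∨ n ∣ D * (u₁ * (y + q) - u₂ * (x + p)) + 1 :=
  (h.pull u₁ v₁ u₂ v₂ p q hD hDD).white hn (pull_mk h0 (by ring) (by ring))
    (pull_mk hu (by ring) (by ring)) (pull_mk hv (by ring) (by ring))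

theorem dvd_comb {n A B C : ℤ} (α β γ c : ℤ) (hA : n ∣ A) (hB : n ∣ B) (hC : n ∣ C)
    (e : α * A + β * B + γ * C = c) : n ∣ c := by
  rw [← e]
  exact ((hA.mul_left α).add (hB.mul_left β)).add (hC.mul_left γ)

theorem eq_two_of_dvd (hn : 2 ≤ n) (h : n ∣ 2) : n = 2 :=
  le_antisymm (Int.le_of_dvd (by norm_num) h) hn

theorem no_parallelogram (h : IsConf n x y S V) (hn : 2 ≤ n) (h00 : S 0 0) (h10 : S 1 0)
    (h01 : S 0 1) (h11 : S 1 1) : False := by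
  have z00 := h.not_dvd hn h00
  have z10 := h.not_dvd hn h10
  have z01 := h.not_dvd hn h01
  have z11 := h.not_dvd hn h11
  rw [add_zero, add_zero] at z00
  rw [add_zero] at z10 z01
  have two (h2 : n ∣ 2) : False := by
    obtain rfl := eq_two_of_dvd hn h2
    have z00' : ¬ (2 ∣ x ∧ 2 ∣ y) := fun ⟨a, b⟩ => z00 a b
    have z10' : ¬ (2 ∣ x + 1 ∧ 2 ∣ y) := fun ⟨a, b⟩ => z10 a b
    have z01' : ¬ (2 ∣ x ∧ 2 ∣ y + 1) := fun ⟨a, b⟩ => z01 a b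
    have z11' : ¬ (2 ∣ x + 1 ∧ 2 ∣ y + 1) := fun ⟨a, b⟩ => z11 a b
    omega
  have w₁ := h.white hn h00 h10 h01
  have w₂ := h.white_triangle hn 1 1 (-1) 0 0 (-1) (D := 1) (by norm_num) (by norm_num) h11
    (eq_of_eq_of_eq h01 (by norm_num) (by norm_num))
    (eq_of_eq_of_eq h10 (by norm_num) (by norm_num))
  have t₁ : n ∣ x + y + 2 ∨ n ∣ x ∨ n ∣ y := by
    rcases w₂ with w | w | w
    · exact Or.inl (dvd_comb (-1) 0 0 _ w w w (by ring))
    · exact Or.inr (Or.inl (dvd_comb (-1) 0 0 _ w w w (by ring)))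
    · exact Or.inr (Or.inr (dvd_comb (-1) 0 0 _ w w w (by ring)))
  rcases w₁ with w | w | w <;> rcases t₁ with t | t | t
  · exact two (dvd_comb (-1) 1 0 _ w t t (by ring))
  · exact z00 t (dvd_comb 1 (-1) 0 _ w t t (by ring))
  · exact z00 (dvd_comb 1 (-1) 0 _ w t t (by ring)) t
  · exact z11 w (dvd_comb (-1) 1 0 _ w t t (by ring))
  · exact two (dvd_comb 2 (-2) 0 _ w t t (by ring))
  · exact z10 w t
  · exact z11 (dvd_comb (-1) 1 0 _ w t t (by ring)) w
  · exact z01 t w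
  · exact two (dvd_comb 2 (-2) 0 _ w t t (by ring))

/-- A line containing three consecutive points of the polygon, and a neighbouring point. -/
theorem dvd_of_collinear (h : IsConf n x y S V) (hn : 2 ≤ n) (hm : S (-1) 0) (h00 : S 0 0)
    (h10 : S 1 0) (h01 : S 0 1) : n ∣ y + 1 := by
  have two (h2 : n = 2) : n ∣ y + 1 := by
    subst h2
    have z00 : ¬ (2 ∣ x + 0 ∧ 2 ∣ y + 0) := fun ⟨a, b⟩ => h.not_dvd hn h00 a b
    have z10 : ¬ (2 ∣ x + 1 ∧ 2 ∣ y + 0) := fun ⟨a, b⟩ => h.not_dvd hn h10 a b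
    omega
  have w₁ := h.white hn h00 h10 h01
  have w₂ := h.white_triangle hn 0 0 (-1) 0 0 1 (D := -1) (by norm_num) (by norm_num) h00 hm h01
  rcases w₁ with w | w | w <;> rcases w₂ with t | t | t
  · exact two (h.eq_of_prime hn Int.prime_two (by norm_num) h00
      (dvd_comb 1 (-1) 0 _ w t t (by ring)) (dvd_comb 1 1 0 _ w t t (by ring)))
  · exact dvd_comb 1 1 0 _ w t t (by ring)
  · exact dvd_comb 0 1 0 _ w t t (by ring)
  · exact dvd_comb 1 1 0 _ w t t (by ring)
  · exact two (eq_two_of_dvd hn (dvd_comb 1 1 0 _ w t t (by ring)))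
  · exact dvd_comb 0 1 0 _ w t t (by ring)
  · exact w
  · exact w
  · exact w

theorem dvd_of_collinear' (h : IsConf n x y S V) (hn : 2 ≤ n) (p q u₁ u₂ v₁ v₂ : ℤ) {D : ℤ}
    (hD : u₁ * v₂ - v₁ * u₂ = D) (hDD : D * D = 1) (hm : S (p - u₁) (q - u₂)) (h0 : S p q)
    (hu : S (p + u₁) (q + u₂)) (hv : S (p + v₁) (q + v₂)) :
    n ∣ D * (u₁ * (y + q) - u₂ * (x + p)) + 1 :=
  (h.pull u₁ v₁ u₂ v₂ p q hD hDD).dvd_of_collinear hn (pull_mk hm (by ring) (by ring))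
    (pull_mk h0 (by ring) (by ring)) (pull_mk hu (by ring) (by ring))
    (pull_mk hv (by ring) (by ring))

/-- The line adjacent to a unit segment of the polygon has a point of the polygon on the side of
any other point. -/
theorem exists_level_one (h : IsConf n x y S V) (h00 : S 0 0) (h10 : S 1 0) {i j : ℤ} (hj : 1 ≤ j)
    (hS : S i j) : ∃ s, S s 1 := by
  obtain ⟨s, hs, hs'⟩ := exists_ceil_div j i (by linarith)
  exact ⟨s, h.closed i j 1 0 0 0 1 (s * j - i) (j - 1 - (s * j - i)) s 1 hS h10 h00 (by norm_num)
    (by linarith) (by linarith) (by linarith) (by ring) (by ring)⟩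

theorem exists_level_one' (h : IsConf n x y S V) (p q u₁ u₂ v₁ v₂ : ℤ) {D : ℤ}
    (hD : u₁ * v₂ - v₁ * u₂ = D) (hDD : D * D = 1) (h0 : S p q) (hu : S (p + u₁) (q + u₂))
    {i j : ℤ} (hj : 1 ≤ j) (hS : S (p + i * u₁ + j * v₁) (q + i * u₂ + j * v₂)) :
    ∃ s, S (p + s * u₁ + v₁) (q + s * u₂ + v₂) := by
  obtain ⟨s, hs⟩ := (h.pull u₁ v₁ u₂ v₂ p q hD hDD).exists_level_one
    (pull_mk h0 (by ring) (by ring)) (pull_mk hu (by ring) (by ring)) hj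
    (pull_mk (i := i) (j := j) hS (by ring) (by ring))
  exact ⟨s, of_pull hs (by ring) (by ring)⟩

/-- The line adjacent to a unit segment of the polygon has at most one point of the polygon. -/
theorem level_one_unique (h : IsConf n x y S V) (hn : 2 ≤ n) (h00 : S 0 0) (h10 : S 1 0)
    {s t : ℤ} (hs : S s 1) (ht : S t 1) : s = t := by
  have key (s t : ℤ) (hs : S s 1) (ht : S t 1) (hlt : s < t) : False := by
    have h1 : S (s + 1) 1 := h.seg hs ht (l := t - s - 1) (m := 1) (by linarith) (by norm_num)
      (by linarith) (by ring) (by ring)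
    exact (h.pull 1 s 0 1 0 0 (D := 1) (by ring) (by norm_num)).no_parallelogram hn
      (pull_mk h00 (by ring) (by ring)) (pull_mk h10 (by ring) (by ring))
      (pull_mk hs (by ring) (by ring)) (pull_mk h1 (by ring) (by ring))
  rcases lt_trichotomy s t with hlt | heq | hgt
  · exact (key s t hs ht hlt).elim
  · exact heq
  · exact (key t s ht hs hgt).elim

theorem level_one_unique' (h : IsConf n x y S V) (hn : 2 ≤ n) (p q u₁ u₂ v₁ v₂ : ℤ) {D : ℤ}
    (hD : u₁ * v₂ - v₁ * u₂ = D) (hDD : D * D = 1) (h0 : S p q) (hu : S (p + u₁) (q + u₂))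
    {s t : ℤ} (hs : S (p + s * u₁ + v₁) (q + s * u₂ + v₂))
    (ht : S (p + t * u₁ + v₁) (q + t * u₂ + v₂)) : s = t :=
  (h.pull u₁ v₁ u₂ v₂ p q hD hDD).level_one_unique hn
    (pull_mk h0 (by ring) (by ring)) (pull_mk hu (by ring) (by ring))
    (pull_mk (i := s) hs (by ring) (by ring)) (pull_mk (i := t) ht (by ring) (by ring))

/-- A point at distance `k ≥ 2` from a line containing three consecutive points of the polygon lies
on a ray from the middle one through a point at distance one. -/
theorem far_point (h : IsConf n x y S V) (hn : 2 ≤ n) (hm : S (-1) 0) (h00 : S 0 0) (h10 : S 1 0)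
    {t k : ℤ} (hk : 2 ≤ k) (hS : S t k) : ∃ s, t = k * s ∧ S s 1 := by
  have e := Int.emod_add_mul_ediv t k
  have r0 := Int.emod_nonneg t (show k ≠ 0 by linarith)
  have rk := Int.emod_lt_of_pos t (show 0 < k by linarith)
  generalize t % k = r at *
  generalize t / k = s at *
  have comb (p a b c : ℤ) (ha : 0 ≤ a) (hb : 0 ≤ b) (hc : 0 ≤ c) (e₁ : a + b + c = k - 1)
      (e₂ : t + b - a = k * p) : S p 1 := by
    obtain ⟨q, hq⟩ : ∃ q, q = b - a := ⟨_, rfl⟩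
    rcases le_total 0 q with hq0 | hq0
    · exact h.closed t k 1 0 0 0 1 q (k - 1 - q) p 1 hS h10 h00 (by norm_num) hq0 (by linarith)
        (by linarith) (by linear_combination e₂ + hq) (by ring)
    · exact h.closed t k (-1) 0 0 0 1 (-q) (k - 1 + q) p 1 hS hm h00 (by norm_num) (by linarith)
        (by linarith) (by linarith) (by linear_combination e₂ + hq) (by ring)
  have hs : S s 1 := comb s r 0 (k - 1 - r) r0 le_rfl (by linarith) (by ring)
    (by linear_combination -e)
  rcases r0.eq_or_lt with hr | hr
  · exact ⟨s, by linarith, hs⟩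
  · have hs' : S (s + 1) 1 := comb (s + 1) 0 (k - r) (r - 1) le_rfl (by linarith) (by linarith)
      (by ring) (by linear_combination -e)
    have := h.level_one_unique hn h00 h10 hs hs'
    linarith

theorem far_point' (h : IsConf n x y S V) (hn : 2 ≤ n) (p q u₁ u₂ v₁ v₂ : ℤ) {D : ℤ}
    (hD : u₁ * v₂ - v₁ * u₂ = D) (hDD : D * D = 1) (hm : S (p - u₁) (q - u₂)) (h0 : S p q)
    (hu : S (p + u₁) (q + u₂)) {t k : ℤ} (hk : 2 ≤ k)
    (hS : S (p + t * u₁ + k * v₁) (q + t * u₂ + k * v₂)) :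
    ∃ s, t = k * s ∧ S (p + s * u₁ + v₁) (q + s * u₂ + v₂) := by
  obtain ⟨s, e, hs⟩ := (h.pull u₁ v₁ u₂ v₂ p q hD hDD).far_point hn
    (pull_mk hm (by ring) (by ring)) (pull_mk h0 (by ring) (by ring))
    (pull_mk hu (by ring) (by ring)) hk (pull_mk (i := t) (j := k) hS (by ring) (by ring))
  exact ⟨s, e, of_pull hs (by ring) (by ring)⟩

theorem _root_.Img.of_affine {E : Set (ℤ × ℤ)} (a b c d e f : ℤ)
    (hdet : a * d - b * c = 1 ∨ a * d - b * c = -1) (he : n ∣ e - a * x - b * y)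
    (hf : n ∣ f - c * x - d * y) (hE : ∀ i j, V i j → (a * i + b * j + e, c * i + d * j + f) ∈ E)
    (hE' : ∀ p q, (p, q) ∈ E → ∃ i j, V i j ∧ p = a * i + b * j + e ∧ q = c * i + d * j + f) :
    Img n x y V E := by
  obtain ⟨k, hk⟩ := he
  obtain ⟨l, hl⟩ := hf
  refine ⟨a, b, c, d, k, l, hdet, fun p q => ⟨fun hpq => ?_, ?_⟩⟩
  · obtain ⟨i, j, hv, rfl, rfl⟩ := hE' p q hpq
    exact ⟨i, j, hv, by linear_combination hk, by linear_combination hl⟩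
  · rintro ⟨i, j, hv, rfl, rfl⟩
    convert hE i j hv using 2
    · linear_combination -hk
    · linear_combination -hl

theorem vert_of_exposed (h : IsConf n x y S V) {p q : ℤ} (g₁ g₂ : ℤ) (hS : S p q)
    (hex : ∀ i j, S i j → (i = p ∧ j = q) ∨ g₁ * p + g₂ * q + 1 ≤ g₁ * i + g₂ * j) : V p q := by
  by_contra hcon
  have := h.supp g₁ g₂ (g₁ * p + g₂ * q + 1) (fun i j hv => (hex i j (h.sub i j hv)).resolve_left (by
    rintro ⟨rfl, rfl⟩
    exact hcon hv)) p q hS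
  linarith

theorem not_vert_of_between (h : IsConf n x y S V) {a₁ a₂ b₁ b₂ l m p q : ℤ} (ha : S a₁ a₂)
    (hb : S b₁ b₂) (hl : 0 ≤ l) (hm : 0 ≤ m) (hpos : 0 < l + m)
    (e₁ : l * a₁ + m * b₁ = (l + m) * p) (e₂ : l * a₂ + m * b₂ = (l + m) * q)
    (hna : ¬ (a₁ = p ∧ a₂ = q)) (hnb : ¬ (b₁ = p ∧ b₂ = q)) : ¬ V p q := fun hv => by
  have := h.ext a₁ a₂ b₁ b₂ a₁ a₂ l m 0 p q ha hb ha hl hm le_rfl (by linarith)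
    (by linear_combination e₁) (by linear_combination e₂) hv
  tauto

theorem classified_triangle (h : IsConf n x y S V) (hn : 2 ≤ n) {m : ℤ} (hm : 1 ≤ m) (hx : n ∣ x)
    (hS : ∀ i j, S i j ↔ (i = 0 ∧ j = 0) ∨ (i = 1 ∧ 0 ≤ j ∧ j ≤ m)) : Classified n x y V := by
  have h00 : S 0 0 := by simp [hS]
  have h10 : S 1 0 := by simp [hS]; linarith
  have h1m : S 1 m := by simp [hS]; linarith
  have v00 : V 0 0 := h.vert_of_exposed 1 0 h00 fun i j hij => by rw [hS] at hij; omega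
  have v10 : V 1 0 := h.vert_of_exposed (-1) 1 h10 fun i j hij => by rw [hS] at hij; omega
  have v1m : V 1 m := h.vert_of_exposed (-1) (-1) h1m fun i j hij => by rw [hS] at hij; omega
  have hV (i j : ℤ) (hv : V i j) : (i = 0 ∧ j = 0) ∨ (i = 1 ∧ j = 0) ∨ (i = 1 ∧ j = m) := by
    have hij := h.sub i j hv
    rw [hS] at hij
    rcases hij with hij | ⟨rfl, h0, hm'⟩
    · exact Or.inl hij
    · by_contra hcon
      exact h.not_vert_of_between h10 h1m (l := m - j) (m := j) (by linarith) h0 (by linarith)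
        (by ring) (by ring) (by omega) (by omega) hv
  have hK : 1 ≤ y + n * (|y| + 1) := by
    have := neg_abs_le y
    nlinarith [abs_nonneg y]
  refine ⟨_, Or.inr (Or.inl ⟨m, y + n * (|y| + 1), hm, hK, ?_, rfl⟩),
    Img.of_affine 1 0 0 1 0 (y + n * (|y| + 1)) (by norm_num) ?_ ?_ ?_ ?_⟩
  · have hg := Int.gcd_dvd_left (y + n * (|y| + 1)) n
    have hg' := Int.gcd_dvd_right (y + n * (|y| + 1)) n
    have hy : ((y + n * (|y| + 1)).gcd n : ℤ) ∣ y := by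
      simpa using dvd_sub hg (hg'.mul_right (|y| + 1))
    have := h.eq_one_of_dvd (by linarith) h00
      (by exact_mod_cast Int.gcd_pos_of_ne_zero_right _ (by linarith))
      (by simpa using hg'.trans hx) (by simpa using hy) hg'
    exact_mod_cast this
  · simpa using hx
  · exact ⟨|y| + 1, by ring⟩
  · intro i j hv
    rcases hV i j hv with ⟨rfl, rfl⟩ | ⟨rfl, rfl⟩ | ⟨rfl, rfl⟩ <;> simp [add_comm]
  · intro p q hpq
    simp only [Set.mem_insert_iff, Set.mem_singleton_iff, Prod.mk.injEq] at hpq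
    rcases hpq with ⟨rfl, rfl⟩ | ⟨rfl, rfl⟩ | ⟨rfl, rfl⟩
    · exact ⟨1, 0, v10, by ring, by ring⟩
    · exact ⟨0, 0, v00, by ring, by ring⟩
    · exact ⟨1, m, v1m, by ring, by ring⟩

theorem classified_of_two_sides (h : IsConf 2 x y S V) {l r : ℤ} (hl : l ≤ 0) (hr : 0 ≤ r)
    (hlr : 2 ≤ r - l) (hx : x % 2 = 1) (hy : y % 2 = 1)
    (hS : ∀ i j, S i j ↔ (j = 0 ∧ l ≤ i ∧ i ≤ r) ∨ (i = 0 ∧ j = 1) ∨ (i = 0 ∧ j = -1)) :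
    Classified 2 x y V := by
  have hl0 : S l 0 := by simp [hS]; linarith
  have hr0 : S r 0 := by simp [hS]; linarith
  have h01 : S 0 1 := by simp [hS]
  have h0m : S 0 (-1) := by simp [hS]
  have v01 : V 0 1 := h.vert_of_exposed 0 (-1) h01 fun i j hij => by rw [hS] at hij; omega
  have v0m : V 0 (-1) := h.vert_of_exposed 0 1 h0m fun i j hij => by rw [hS] at hij; omega
  have vl0 (hl' : l ≤ -1) : V l 0 :=
    h.vert_of_exposed 1 0 hl0 fun i j hij => by rw [hS] at hij; omega
  have vr0 (hr' : 1 ≤ r) : V r 0 :=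
    h.vert_of_exposed (-1) 0 hr0 fun i j hij => by rw [hS] at hij; omega
  have n00 : ¬ V 0 0 := h.not_vert_of_between h01 h0m (l := 1) (m := 1) (by norm_num) (by norm_num)
    (by norm_num) (by ring) (by ring) (by omega) (by omega)
  have hV (i j : ℤ) (hv : V i j) : (i = l ∧ j = 0) ∨ (i = r ∧ j = 0) ∨ (i = 0 ∧ j = 1) ∨
      (i = 0 ∧ j = -1) := by
    have hij := h.sub i j hv
    rw [hS] at hij
    rcases hij with ⟨rfl, h0, hm'⟩ | hij | hij
    · by_contra hcon
      exact h.not_vert_of_between hl0 hr0 (l := r - i) (m := i - l) (by linarith) (by linarith)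
        (by linarith) (by ring) (by ring) (by omega) (by omega) hv
    · tauto
    · tauto
  rcases hl.eq_or_lt with rfl | hl'
  · refine ⟨_, Or.inr (Or.inr (Or.inl ⟨rfl, r, by linarith, rfl⟩)),
      Img.of_affine 0 1 (-1) r 1 (1 + r) (by norm_num) ?_ ?_ ?_ ?_⟩
    · omega
    · obtain ⟨k, hk⟩ : ∃ k, y = 2 * k + 1 := ⟨y / 2, by omega⟩
      obtain ⟨k', hk'⟩ : ∃ k, x = 2 * k + 1 := ⟨x / 2, by omega⟩
      exact ⟨1 + k' - r * k, by subst hk hk'; ring⟩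
    · intro i j hv
      rcases hV i j hv with ⟨rfl, rfl⟩ | ⟨rfl, rfl⟩ | ⟨rfl, rfl⟩ | ⟨rfl, rfl⟩
      · exact (n00 hv).elim
      · simp
      · right; right; simp; ring
      · simp
    · intro p q hpq
      simp only [Set.mem_insert_iff, Set.mem_singleton_iff, Prod.mk.injEq] at hpq
      rcases hpq with ⟨rfl, rfl⟩ | ⟨rfl, rfl⟩ | ⟨rfl, rfl⟩
      · exact ⟨r, 0, vr0 (by linarith), by ring, by ring⟩
      · exact ⟨0, -1, v0m, by ring, by ring⟩
      · exact ⟨0, 1, v01, by ring, by ring⟩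
  · rcases hr.eq_or_lt with rfl | hr'
    · refine ⟨_, Or.inr (Or.inr (Or.inl ⟨rfl, -l, by linarith, rfl⟩)),
        Img.of_affine 0 1 1 (-l) 1 (1 - l) (by norm_num) ?_ ?_ ?_ ?_⟩
      · omega
      · obtain ⟨k, hk⟩ : ∃ k, y = 2 * k + 1 := ⟨y / 2, by omega⟩
        obtain ⟨k', hk'⟩ : ∃ k, x = 2 * k + 1 := ⟨x / 2, by omega⟩
        exact ⟨-k' + l * k, by subst hk hk'; ring⟩
      · intro i j hv
        rcases hV i j hv with ⟨rfl, rfl⟩ | ⟨rfl, rfl⟩ | ⟨rfl, rfl⟩ | ⟨rfl, rfl⟩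
        · simp
        · exact (n00 hv).elim
        · right; right; simp; ring
        · simp
      · intro p q hpq
        simp only [Set.mem_insert_iff, Set.mem_singleton_iff, Prod.mk.injEq] at hpq
        rcases hpq with ⟨rfl, rfl⟩ | ⟨rfl, rfl⟩ | ⟨rfl, rfl⟩
        · exact ⟨l, 0, vl0 (by linarith), by ring, by ring⟩
        · exact ⟨0, -1, v0m, by ring, by ring⟩
        · exact ⟨0, 1, v01, by ring, by ring⟩
    · refine ⟨_, Or.inl ⟨rfl, r, -l, by linarith, by linarith, rfl⟩,
        Img.of_affine 1 0 0 1 1 1 (by norm_num) ?_ ?_ ?_ ?_⟩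
      · omega
      · omega
      · intro i j hv
        rcases hV i j hv with ⟨rfl, rfl⟩ | ⟨rfl, rfl⟩ | ⟨rfl, rfl⟩ | ⟨rfl, rfl⟩ <;>
          simp [add_comm]
      · intro p q hpq
        simp only [Set.mem_insert_iff, Set.mem_singleton_iff, Prod.mk.injEq] at hpq
        rcases hpq with ⟨rfl, rfl⟩ | ⟨rfl, rfl⟩ | ⟨rfl, rfl⟩ | ⟨rfl, rfl⟩
        · exact ⟨0, -1, v0m, by ring, by ring⟩
        · exact ⟨r, 0, vr0 (by linarith), by ring, by ring⟩
        · exact ⟨0, 1, v01, by ring, by ring⟩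
        · exact ⟨l, 0, vl0 (by linarith), by ring, by ring⟩

theorem classified_six_points (h : IsConf 2 x y S V) (hx : x % 2 = 1) (hy : y % 2 = 1)
    (hS : ∀ i j, S i j ↔ (i = -1 ∧ j = 0) ∨ (i = 0 ∧ j = 0) ∨ (i = 1 ∧ j = 0) ∨
      (i = 0 ∧ j = 1) ∨ (i = 0 ∧ j = 2) ∨ (i = 2 ∧ j = -1)) : Classified 2 x y V := by
  have hm0 : S (-1) 0 := by simp [hS]
  have h00 : S 0 0 := by simp [hS]
  have h10 : S 1 0 := by simp [hS]
  have h01 : S 0 1 := by simp [hS]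
  have h02 : S 0 2 := by simp [hS]
  have h2m : S 2 (-1) := by simp [hS]
  have vm0 : V (-1) 0 := h.vert_of_exposed 1 0 hm0 fun i j hij => by rw [hS] at hij; omega
  have v02 : V 0 2 := h.vert_of_exposed 0 (-1) h02 fun i j hij => by rw [hS] at hij; omega
  have v2m : V 2 (-1) := h.vert_of_exposed 0 1 h2m fun i j hij => by rw [hS] at hij; omega
  have n00 : ¬ V 0 0 := h.not_vert_of_between hm0 h10 (l := 1) (m := 1) (by norm_num) (by norm_num)
    (by norm_num) (by ring) (by ring) (by omega) (by omega)
  have n10 : ¬ V 1 0 := h.not_vert_of_between h2m h01 (l := 1) (m := 1) (by norm_num) (by norm_num)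
    (by norm_num) (by ring) (by ring) (by omega) (by omega)
  have n01 : ¬ V 0 1 := h.not_vert_of_between h00 h02 (l := 1) (m := 1) (by norm_num) (by norm_num)
    (by norm_num) (by ring) (by ring) (by omega) (by omega)
  have hV (i j : ℤ) (hv : V i j) : (i = -1 ∧ j = 0) ∨ (i = 0 ∧ j = 2) ∨ (i = 2 ∧ j = -1) := by
    have hij := h.sub i j hv
    rw [hS] at hij
    rcases hij with hij | ⟨rfl, rfl⟩ | ⟨rfl, rfl⟩ | ⟨rfl, rfl⟩ | hij | hij <;> tauto
  refine ⟨_, Or.inr (Or.inr (Or.inr (Or.inl ⟨rfl, rfl⟩))),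
    Img.of_affine 1 1 0 1 0 (-1) (by norm_num) (by omega) (by omega) ?_ ?_⟩
  · intro i j hv
    rcases hV i j hv with ⟨rfl, rfl⟩ | ⟨rfl, rfl⟩ | ⟨rfl, rfl⟩ <;> simp
  · intro p q hpq
    simp only [Set.mem_insert_iff, Set.mem_singleton_iff, Prod.mk.injEq] at hpq
    rcases hpq with ⟨rfl, rfl⟩ | ⟨rfl, rfl⟩ | ⟨rfl, rfl⟩
    · exact ⟨2, -1, v2m, by ring, by ring⟩
    · exact ⟨-1, 0, vm0, by ring, by ring⟩
    · exact ⟨0, 2, v02, by ring, by ring⟩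

theorem classified_four_points (h : IsConf 3 x y S V)
    (hxy : (x % 3 = 1 ∧ y % 3 = 2) ∨ (x % 3 = 2 ∧ y % 3 = 1))
    (hS : ∀ i j, S i j ↔ (i = 0 ∧ j = 0) ∨ (i = 1 ∧ j = 0) ∨ (i = 0 ∧ j = 1) ∨
      (i = -1 ∧ j = -1)) : Classified 3 x y V := by
  have h10 : S 1 0 := by simp [hS]
  have h01 : S 0 1 := by simp [hS]
  have hmm : S (-1) (-1) := by simp [hS]
  have vmm : V (-1) (-1) := h.vert_of_exposed 1 1 hmm fun i j hij => by rw [hS] at hij; omega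
  have v10 : V 1 0 := h.vert_of_exposed (-1) 0 h10 fun i j hij => by rw [hS] at hij; omega
  have v01 : V 0 1 := h.vert_of_exposed 0 (-1) h01 fun i j hij => by rw [hS] at hij; omega
  have n00 : ¬ V 0 0 := fun hv => by
    have := h.ext 1 0 0 1 (-1) (-1) 1 1 1 0 0 h10 h01 hmm (by norm_num) (by norm_num)
      (by norm_num) (by norm_num) (by norm_num) (by norm_num) hv
    omega
  have hV (i j : ℤ) (hv : V i j) : (i = 1 ∧ j = 0) ∨ (i = 0 ∧ j = 1) ∨ (i = -1 ∧ j = -1) := by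
    have hij := h.sub i j hv
    rw [hS] at hij
    rcases hij with ⟨rfl, rfl⟩ | hij | hij | hij <;> tauto
  rcases hxy with ⟨hx, hy⟩ | ⟨hx, hy⟩
  · refine ⟨_, Or.inr (Or.inr (Or.inr (Or.inr ⟨rfl, rfl⟩))),
      Img.of_affine 0 (-1) (-1) (-1) 1 0 (by norm_num) (by omega) (by omega) ?_ ?_⟩
    · intro i j hv
      rcases hV i j hv with ⟨rfl, rfl⟩ | ⟨rfl, rfl⟩ | ⟨rfl, rfl⟩ <;> simp
    · intro p q hpq
      simp only [Set.mem_insert_iff, Set.mem_singleton_iff, Prod.mk.injEq] at hpq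
      rcases hpq with ⟨rfl, rfl⟩ | ⟨rfl, rfl⟩ | ⟨rfl, rfl⟩
      · exact ⟨1, 0, v10, by ring, by ring⟩
      · exact ⟨0, 1, v01, by ring, by ring⟩
      · exact ⟨-1, -1, vmm, by ring, by ring⟩
  · refine ⟨_, Or.inr (Or.inr (Or.inr (Or.inr ⟨rfl, rfl⟩))),
      Img.of_affine (-1) 0 (-1) (-1) 1 0 (by norm_num) (by omega) (by omega) ?_ ?_⟩
    · intro i j hv
      rcases hV i j hv with ⟨rfl, rfl⟩ | ⟨rfl, rfl⟩ | ⟨rfl, rfl⟩ <;> simp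
    · intro p q hpq
      simp only [Set.mem_insert_iff, Set.mem_singleton_iff, Prod.mk.injEq] at hpq
      rcases hpq with ⟨rfl, rfl⟩ | ⟨rfl, rfl⟩ | ⟨rfl, rfl⟩
      · exact ⟨0, 1, v01, by ring, by ring⟩
      · exact ⟨1, 0, v10, by ring, by ring⟩
      · exact ⟨-1, -1, vmm, by ring, by ring⟩

theorem classified_of_confined (h : IsConf n x y S V) (hn : 2 ≤ n) (hm : S (-1) 0) (h00 : S 0 0)
    (h10 : S 1 0) (hc : ∀ i j, S i j → -1 ≤ j ∧ j ≤ 1) : Classified n x y V := by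
  obtain ⟨r, hr, hrmax⟩ := Int.exists_greatest_of_bdd (P := fun i => S i 0)
    (by
      obtain ⟨B, hB⟩ := h.bdd 1 0
      exact ⟨B, fun z hz => by linarith [hB z 0 hz]⟩) ⟨0, h00⟩
  obtain ⟨l, hl, hlmin⟩ := Int.exists_least_of_bdd (P := fun i => S i 0)
    (by
      obtain ⟨B, hB⟩ := h.bdd (-1) 0
      exact ⟨-B, fun z hz => by linarith [hB z 0 hz]⟩) ⟨0, h00⟩
  have hr1 := hrmax 1 h10
  have hl1 := hlmin (-1) hm
  have hrow (i : ℤ) : S i 0 ↔ l ≤ i ∧ i ≤ r :=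
    ⟨fun hi => ⟨hlmin i hi, hrmax i hi⟩, fun hi => h.seg hl hr (l := r - i) (m := i - l)
      (by linarith) (by linarith) (by linarith) (by ring) (by ring)⟩
  have dtop {t : ℤ} (ht : S t 1) : n ∣ y + 1 := by
    have := h.dvd_of_collinear' hn 0 0 1 0 t 1 (D := 1) (by ring) (by norm_num)
      (by simpa using hm) h00 (by simpa using h10) (by simpa using ht)
    simpa using this
  have dbot {s : ℤ} (hs : S s (-1)) : n ∣ -y + 1 := by
    have := h.dvd_of_collinear' hn 0 0 1 0 s (-1) (D := -1) (by ring) (by norm_num)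
      (by simpa using hm) h00 (by simpa using h10) (by simpa using hs)
    simpa using this
  have utop {s t : ℤ} (hs : S s 1) (ht : S t 1) : s = t := h.level_one_unique hn h00 h10 hs ht
  have ubot {s t : ℤ} (hs : S s (-1)) (ht : S t (-1)) : s = t :=
    h.level_one_unique' hn 0 0 1 0 0 (-1) (D := -1) (by ring) (by norm_num) h00
      (by simpa using h10) (by simpa using hs) (by simpa using ht)
  by_cases htop : ∃ t, S t 1 <;> by_cases hbot : ∃ s, S s (-1)
  · obtain ⟨t, ht⟩ := htop
    obtain ⟨s, hs⟩ := hbot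
    have d₁ := dtop ht
    have d₂ := dbot hs
    obtain rfl := eq_two_of_dvd hn (dvd_comb 1 1 0 _ d₁ d₂ d₁ (by ring))
    have p₁ : ¬ (2 ∣ x + t ∧ 2 ∣ y + 1) := fun ⟨a, b⟩ => h.not_dvd hn ht a b
    have p₂ : ¬ (2 ∣ x + s ∧ 2 ∣ y + -1) := fun ⟨a, b⟩ => h.not_dvd hn hs a b
    obtain ⟨e, he⟩ : ∃ e, t + s = 2 * e := ⟨(t + s) / 2, by omega⟩
    have hse : S e 0 := h.seg ht hs (l := 1) (m := 1) (by norm_num) (by norm_num) (by norm_num)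
      (by linarith) (by ring)
    have := (hrow e).1 hse
    refine Classified.of_pull 1 (t - e) 0 1 e 0 (D := 1) (by ring) (by norm_num) ?_
    refine (h.pull 1 (t - e) 0 1 e 0 (D := 1) (by ring) (by norm_num)).classified_of_two_sides
      (l := l - e) (r := r - e) (by linarith) (by linarith) (by linarith) ?_ (by omega) ?_
    · obtain ⟨k, rfl⟩ : ∃ k, y = 2 * k + 1 := ⟨y / 2, by omega⟩
      obtain ⟨k', hk'⟩ : ∃ k, x = t + 2 * k + 1 := ⟨(x - t) / 2, by omega⟩
      rw [hk', show 1 * (1 * (t + 2 * k' + 1 + e) - (t - e) * (2 * k + 1 + 0)) =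
        1 + 2 * (k' + e - (t - e) * k) by ring, Int.add_mul_emod_self_left]
      norm_num
    · intro i j
      constructor
      · intro hij
        have hij' : S (1 * i + (t - e) * j + e) (0 * i + 1 * j + 0) := hij
        have hj := hc _ _ hij'
        obtain rfl | rfl | rfl : j = 0 ∨ j = 1 ∨ j = -1 := by omega
        · left
          have := (hrow (1 * i + (t - e) * 0 + e)).1 (by simpa using hij')
          exact ⟨rfl, by linarith, by linarith⟩
        · have := utop ht (t := 1 * i + (t - e) * 1 + e)
            (eq_of_eq_of_eq hij' rfl (by ring))
          right; left
          exact ⟨by linarith, rfl⟩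
        · have := ubot hs (t := 1 * i + (t - e) * (-1) + e)
            (eq_of_eq_of_eq hij' rfl (by ring))
          right; right
          exact ⟨by linarith, rfl⟩
      · rintro (⟨rfl, h₁, h₂⟩ | ⟨rfl, rfl⟩ | ⟨rfl, rfl⟩)
        · exact pull_mk ((hrow (i + e)).2 ⟨by linarith, by linarith⟩) (by ring) (by ring)
        · exact pull_mk ht (by ring) (by ring)
        · exact pull_mk hs (by linarith) (by ring)
  · obtain ⟨t, ht⟩ := htop
    refine Classified.of_pull (l - t) 1 (-1) 0 t 1 (D := 1) (by ring) (by norm_num) ?_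
    refine (h.pull (l - t) 1 (-1) 0 t 1 (D := 1) (by ring) (by norm_num)).classified_triangle hn
      (m := r - l) (by linarith) ?_ fun i j => ⟨fun hij => ?_, ?_⟩
    · exact dvd_comb (-1) 0 0 _ (dtop ht) (dtop ht) (dtop ht) (by ring)
    · have hij' : S ((l - t) * i + 1 * j + t) (-1 * i + 0 * j + 1) := hij
      have hj := hc _ _ hij'
      obtain rfl | rfl | rfl : i = 0 ∨ i = 1 ∨ i = 2 := by omega
      · have := utop ht (t := (l - t) * 0 + 1 * j + t)
            (eq_of_eq_of_eq hij' rfl (by ring))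
        left
        exact ⟨rfl, by linarith⟩
      · have := (hrow ((l - t) * 1 + 1 * j + t)).1 (by simpa using hij')
        right
        exact ⟨rfl, by linarith, by linarith⟩
      · exact (hbot ⟨_, eq_of_eq_of_eq hij' rfl (by ring)⟩).elim
    · rintro (⟨rfl, rfl⟩ | ⟨rfl, h₁, h₂⟩)
      · exact pull_mk ht (by ring) (by ring)
      · exact pull_mk ((hrow (l + j)).2 ⟨by linarith, by linarith⟩) (by ring) (by ring)
  · obtain ⟨t, ht⟩ := hbot
    refine Classified.of_pull (l - t) 1 1 0 t (-1) (D := -1) (by ring) (by norm_num) ?_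
    refine (h.pull (l - t) 1 1 0 t (-1) (D := -1) (by ring) (by norm_num)).classified_triangle hn
      (m := r - l) (by linarith) ?_ fun i j => ⟨fun hij => ?_, ?_⟩
    · exact dvd_comb (-1) 0 0 _ (dbot ht) (dbot ht) (dbot ht) (by ring)
    · have hij' : S ((l - t) * i + 1 * j + t) (1 * i + 0 * j + -1) := hij
      have hj := hc _ _ hij'
      obtain rfl | rfl | rfl : i = 0 ∨ i = 1 ∨ i = 2 := by omega
      · have := ubot ht (t := (l - t) * 0 + 1 * j + t)
            (eq_of_eq_of_eq hij' rfl (by ring))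
        left
        exact ⟨rfl, by linarith⟩
      · have := (hrow ((l - t) * 1 + 1 * j + t)).1 (by simpa using hij')
        right
        exact ⟨rfl, by linarith, by linarith⟩
      · exact (htop ⟨_, eq_of_eq_of_eq hij' rfl (by ring)⟩).elim
    · rintro (⟨rfl, rfl⟩ | ⟨rfl, h₁, h₂⟩)
      · exact pull_mk ht (by ring) (by ring)
      · exact pull_mk ((hrow (l + j)).2 ⟨by linarith, by linarith⟩) (by ring) (by ring)
  · exfalso
    obtain ⟨i, j, hij, hne⟩ := h.nondeg 0 1 0 (by norm_num)
    have hj := hc _ _ hij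
    obtain rfl | rfl | rfl : j = 0 ∨ j = 1 ∨ j = -1 := by omega
    · simp at hne
    · exact htop ⟨_, hij⟩
    · exact hbot ⟨_, hij⟩

theorem classified_of_cross_of_two_le (h : IsConf n x y S V) (hn : 2 ≤ n) (hm : S (-1) 0)
    (h00 : S 0 0) (h10 : S 1 0) (h01 : S 0 1) (h02 : S 0 2) {t k : ℤ} (ht : 2 ≤ t)
    (hS : S t k) : Classified n x y V := by
  have d₁ := h.dvd_of_collinear hn hm h00 h10 h01
  have d₂ := h.dvd_of_collinear' hn 0 1 0 1 1 (-1) (D := -1) (by ring) (by norm_num)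
    (by simpa using h00) h01 (by simpa using h02) (by simpa using h10)
  have d₃ := h.dvd_of_collinear' hn 0 1 0 1 (-1) (-1) (D := 1) (by ring) (by norm_num)
    (by simpa using h00) h01 (by simpa using h02) (by simpa using hm)
  obtain rfl := eq_two_of_dvd hn (dvd_comb 1 1 0 _ d₂ d₃ d₁ (by ring))
  have right {i j : ℤ} (hi : 2 ≤ i) (hij : S i j) : i = 2 ∧ j = -1 := by
    obtain ⟨s, hs, hs'⟩ := h.far_point' hn 0 1 0 1 1 (-1) (D := -1) (by ring) (by norm_num)
      (by simpa using h00) h01 (by simpa using h02) (t := j - 1 + i) hi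
      (eq_of_eq_of_eq hij (by ring) (by ring))
    obtain rfl := h.level_one_unique' hn 0 1 0 1 1 (-1) (D := -1) (by ring) (by norm_num) h01
      (by simpa using h02) hs' (t := 0) (by simpa using h10)
    by_cases hi3 : 3 ≤ i
    · obtain ⟨s, hs, -⟩ := h.far_point' hn 0 0 1 0 0 (-1) (D := -1) (by ring) (by norm_num)
        (by simpa using hm) h00 (by simpa using h10) (t := i) (k := i - 1) (by linarith)
        (eq_of_eq_of_eq hij (by ring) (by linarith))
      rcases le_or_gt s 1 with h1 | h1 <;> nlinarith
    · omega
  obtain ⟨rfl, rfl⟩ := right ht hS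
  refine h.classified_six_points (by omega) (by omega) fun i j => ⟨fun hij => ?_, ?_⟩
  · rcases le_or_gt 2 j with hj | hj
    · obtain ⟨s, rfl, hs⟩ := h.far_point hn hm h00 h10 hj hij
      obtain rfl := h.level_one_unique hn h00 h10 hs h01
      rw [mul_zero] at hij ⊢
      by_cases hj3 : 3 ≤ j
      · have h03 : S 0 3 := h.seg h02 hij (l := j - 3) (m := 1) (by linarith) (by norm_num)
          (by linarith) (by ring) (by ring)
        obtain ⟨s, hs, -⟩ := h.far_point' hn 0 2 0 1 1 (-2) (D := -1) (by ring) (by norm_num)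
          (by simpa using h01) h02 (by simpa using h03) (t := 1) (k := 2) le_rfl
          (eq_of_eq_of_eq hS (by ring) (by ring))
        omega
      · omega
    rcases le_or_gt j (-2) with hj' | hj'
    · obtain ⟨s, rfl, hs⟩ := h.far_point' hn 0 0 1 0 0 (-1) (D := -1) (by ring) (by norm_num)
        (by simpa using hm) h00 (by simpa using h10) (t := i) (k := -j) (by linarith)
        (eq_of_eq_of_eq hij (by ring) (by ring))
      obtain rfl := h.level_one_unique' hn 0 0 1 0 0 (-1) (D := -1) (by ring) (by norm_num) h00
        (by simpa using h10) hs (t := 2) (by simpa using hS)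
      have := right (by linarith) hij
      omega
    obtain rfl | rfl | rfl : j = 1 ∨ j = 0 ∨ j = -1 := by omega
    · obtain rfl := h.level_one_unique hn h00 h10 hij h01
      simp
    · rcases le_or_gt 2 i with hi | hi
      · have := right hi hij
        omega
      rcases le_or_gt i (-2) with hi' | hi'
      · have h20 : S (-2) 0 := h.seg hm hij (l := -2 - i) (m := 1) (by linarith) (by norm_num)
          (by linarith) (by ring) (by ring)
        obtain ⟨s, hs, -⟩ := h.far_point' hn (-1) 0 1 0 0 1 (D := 1) (by ring) (by norm_num)
          (by simpa using h20) hm (by simpa using h00) (t := 1) (k := 2) le_rfl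
          (eq_of_eq_of_eq h02 (by ring) (by ring))
        omega
      · omega
    · obtain rfl := h.level_one_unique' hn 0 0 1 0 0 (-1) (D := -1) (by ring) (by norm_num) h00
        (by simpa using h10) (s := i) (by simpa using hij) (t := 2) (by simpa using hS)
      simp
  · rintro (⟨rfl, rfl⟩ | ⟨rfl, rfl⟩ | ⟨rfl, rfl⟩ | ⟨rfl, rfl⟩ | ⟨rfl, rfl⟩ | ⟨rfl, rfl⟩) <;>
      assumption

theorem classified_of_cross (h : IsConf n x y S V) (hn : 2 ≤ n) (hm : S (-1) 0)
    (h00 : S 0 0) (h10 : S 1 0) (h01 : S 0 1) (h02 : S 0 2) : Classified n x y V := by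
  by_cases hc : ∀ i j, S i j → -1 ≤ i ∧ i ≤ 1
  · refine Classified.of_pull 0 1 1 0 0 1 (D := -1) (by ring) (by norm_num) ?_
    refine (h.pull 0 1 1 0 0 1 (D := -1) (by ring) (by norm_num)).classified_of_confined hn
      (pull_mk h00 (by ring) (by ring)) (pull_mk h01 (by ring) (by ring))
      (pull_mk h02 (by ring) (by ring)) fun i j hij => ?_
    simpa using hc _ _ hij
  · push Not at hc
    obtain ⟨i, j, hij, hi⟩ := hc
    rcases le_or_gt (-1) i with hi' | hi'
    · exact h.classified_of_cross_of_two_le hn hm h00 h10 h01 h02 (hi hi') hij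
    · refine Classified.of_pull (-1) 0 0 1 0 0 (D := -1) (by ring) (by norm_num) ?_
      exact (h.pull (-1) 0 0 1 0 0 (D := -1) (by ring)
        (by norm_num)).classified_of_cross_of_two_le hn (pull_mk h10 (by ring) (by ring))
        (pull_mk h00 (by ring) (by ring)) (pull_mk hm (by ring) (by ring))
        (pull_mk h01 (by ring) (by ring)) (pull_mk h02 (by ring) (by ring)) (t := -i) (k := j)
        (by linarith) (pull_mk hij (by ring) (by ring))

theorem classified_of_collinear_of_two_le (h : IsConf n x y S V) (hn : 2 ≤ n) (hm : S (-1) 0)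
    (h00 : S 0 0) (h10 : S 1 0) {t k : ℤ} (hk : 2 ≤ k) (hS : S t k) : Classified n x y V := by
  obtain ⟨s, rfl, hs⟩ := h.far_point hn hm h00 h10 hk hS
  have hs2 : S (2 * s) 2 := h.seg h00 hS (l := k - 2) (m := 2) (by linarith) (by norm_num)
    (by linarith) (by ring) (by ring)
  refine Classified.of_pull 1 s 0 1 0 0 (D := 1) (by ring) (by norm_num) ?_
  exact (h.pull 1 s 0 1 0 0 (D := 1) (by ring) (by norm_num)).classified_of_cross hn
    (pull_mk hm (by ring) (by ring)) (pull_mk h00 (by ring) (by ring))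
    (pull_mk h10 (by ring) (by ring)) (pull_mk hs (by ring) (by ring))
    (pull_mk hs2 (by ring) (by ring))

/-- The classification of polygons with three equally spaced lattice points on a line. -/
theorem classified_of_collinear (h : IsConf n x y S V) (hn : 2 ≤ n) (hm : S (-1) 0)
    (h00 : S 0 0) (h10 : S 1 0) : Classified n x y V := by
  by_cases hc : ∀ i j, S i j → -1 ≤ j ∧ j ≤ 1
  · exact h.classified_of_confined hn hm h00 h10 hc
  · push Not at hc
    obtain ⟨i, j, hij, hj⟩ := hc
    rcases le_or_gt (-1) j with hj' | hj'
    · exact h.classified_of_collinear_of_two_le hn hm h00 h10 (hj hj') hij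
    · refine Classified.of_pull 1 0 0 (-1) 0 0 (D := -1) (by ring) (by norm_num) ?_
      exact (h.pull 1 0 0 (-1) 0 0 (D := -1) (by ring)
        (by norm_num)).classified_of_collinear_of_two_le hn (pull_mk hm (by ring) (by ring))
        (pull_mk h00 (by ring) (by ring)) (pull_mk h10 (by ring) (by ring)) (t := i) (k := -j)
        (by linarith) (pull_mk hij (by ring) (by ring))

theorem classified_of_centred (h : IsConf n x y S V) (hn : 2 ≤ n)
    (hS : ∀ i j, S i j ↔ (i = 0 ∧ j = 0) ∨ (i = 1 ∧ j = 0) ∨ (i = 0 ∧ j = 1) ∨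
      (i = -1 ∧ j = -1)) : Classified n x y V := by
  have h00 : S 0 0 := by simp [hS]
  have h10 : S 1 0 := by simp [hS]
  have h01 : S 0 1 := by simp [hS]
  have hmm : S (-1) (-1) := by simp [hS]
  have W₁ := h.white hn h00 h10 h01
  have W₂ : n ∣ y - 2 * x ∨ n ∣ y - x + 1 ∨ n ∣ 1 - x := by
    have := h.white_triangle hn 0 0 0 1 (-1) (-1) (D := 1) (by ring) (by norm_num) h00
      (by simpa using h01) (by simpa using hmm)
    ring_nf at this ⊢
    exact this
  have W₃ : n ∣ x - 2 * y ∨ n ∣ x - y + 1 ∨ n ∣ 1 - y := by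
    have := h.white_triangle hn 0 0 1 0 (-1) (-1) (D := -1) (by ring) (by norm_num) h00
      (by simpa using h10) (by simpa using hmm)
    ring_nf at this ⊢
    exact this
  have z00 : ¬ (n ∣ x + 0 ∧ n ∣ y + 0) := fun ⟨a, b⟩ => h.not_dvd hn h00 a b
  have z10 : ¬ (n ∣ x + 1 ∧ n ∣ y + 0) := fun ⟨a, b⟩ => h.not_dvd hn h10 a b
  have z01 : ¬ (n ∣ x + 0 ∧ n ∣ y + 1) := fun ⟨a, b⟩ => h.not_dvd hn h01 a b
  have zmm : ¬ (n ∣ x + -1 ∧ n ∣ y + -1) := fun ⟨a, b⟩ => h.not_dvd hn hmm a b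
  have two (h2 : n ∣ 2) : n = 3 := by
    obtain rfl := eq_two_of_dvd hn h2
    omega
  have three (h3 : n ∣ 3) : n = 3 := by
    have := Int.le_of_dvd (by norm_num) h3
    obtain rfl | h3' : n = 2 ∨ n = 3 := by omega
    · omega
    · exact h3'
  obtain rfl : n = 3 := by
    rcases W₁ with w₁ | w₁ | w₁ <;> rcases W₂ with w₂ | w₂ | w₂ <;> rcases W₃ with w₃ | w₃ | w₃
    · exact h.eq_of_prime hn Int.prime_three (by norm_num) h00
        (dvd_comb 1 (-1) 0 _ w₁ w₂ w₃ (by ring)) (dvd_comb 2 1 0 _ w₁ w₂ w₃ (by ring))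
    · exact three (dvd_comb 1 2 3 _ w₁ w₂ w₃ (by ring))
    · exact three (dvd_comb 2 1 3 _ w₁ w₂ w₃ (by ring))
    · exact three (dvd_comb 1 3 2 _ w₁ w₂ w₃ (by ring))
    · exact two (dvd_comb 0 1 1 _ w₁ w₂ w₃ (by ring))
    · exact three (dvd_comb 1 1 2 _ w₁ w₂ w₃ (by ring))
    · exact three (dvd_comb 2 3 1 _ w₁ w₂ w₃ (by ring))
    · exact three (dvd_comb 1 2 1 _ w₁ w₂ w₃ (by ring))
    · exact two (dvd_comb 1 1 1 _ w₁ w₂ w₃ (by ring))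
    · exact three (dvd_comb 3 2 1 _ w₁ w₂ w₃ (by ring))
    · exact two (dvd_comb 1 1 1 _ w₁ w₂ w₃ (by ring))
    · exact three (dvd_comb 2 1 1 _ w₁ w₂ w₃ (by ring))
    · exact three (dvd_comb 1 2 1 _ w₁ w₂ w₃ (by ring))
    · exact two (dvd_comb 0 1 1 _ w₁ w₂ w₃ (by ring))
    · exact three (dvd_comb 1 1 1 _ w₁ w₂ w₃ (by ring))
    · exact two (dvd_comb 1 1 0 _ w₁ w₂ w₃ (by ring))
    · exact two (dvd_comb 1 1 0 _ w₁ w₂ w₃ (by ring))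
    · exact two (dvd_comb 1 1 0 _ w₁ w₂ w₃ (by ring))
    · exact three (dvd_comb 3 1 2 _ w₁ w₂ w₃ (by ring))
    · exact three (dvd_comb 1 1 2 _ w₁ w₂ w₃ (by ring))
    · exact two (dvd_comb 1 0 1 _ w₁ w₂ w₃ (by ring))
    · exact two (dvd_comb 1 1 1 _ w₁ w₂ w₃ (by ring))
    · exact two (dvd_comb 0 1 1 _ w₁ w₂ w₃ (by ring))
    · exact two (dvd_comb 1 0 1 _ w₁ w₂ w₃ (by ring))
    · exact three (dvd_comb 2 1 1 _ w₁ w₂ w₃ (by ring))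
    · exact three (dvd_comb 1 1 1 _ w₁ w₂ w₃ (by ring))
    · exact two (dvd_comb 1 0 1 _ w₁ w₂ w₃ (by ring))
  exact h.classified_four_points (by omega) hS

theorem classified_of_unimodular_triangle (h : IsConf n x y S V) (hn : 2 ≤ n)
    (hT : ∀ p q u₁ u₂, (u₁ ≠ 0 ∨ u₂ ≠ 0) → S (p - u₁) (q - u₂) → S p q → S (p + u₁) (q + u₂) →
      False) (h00 : S 0 0) (h10 : S 1 0) (h01 : S 0 1) : Classified n x y V := by
  have mid {a₁ a₂ b₁ b₂ : ℤ} (ha : S a₁ a₂) (hb : S b₁ b₂) (h₁ : a₁ % 2 = b₁ % 2)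
      (h₂ : a₂ % 2 = b₂ % 2) : a₁ = b₁ ∧ a₂ = b₂ := by
    by_contra hne
    obtain ⟨p, hp⟩ : ∃ p, a₁ + b₁ = 2 * p := ⟨(a₁ + b₁) / 2, by omega⟩
    obtain ⟨q, hq⟩ : ∃ q, a₂ + b₂ = 2 * q := ⟨(a₂ + b₂) / 2, by omega⟩
    refine hT p q (b₁ - p) (b₂ - q) (by omega) (eq_of_eq_of_eq ha (by linarith) (by linarith))
      (h.seg ha hb (l := 1) (m := 1) (by norm_num) (by norm_num) (by norm_num) (by linarith)
      (by linarith)) (eq_of_eq_of_eq hb (by ring) (by ring))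
  have odd {i j : ℤ} (hij : S i j) : (i = 0 ∧ j = 0) ∨ (i = 1 ∧ j = 0) ∨ (i = 0 ∧ j = 1) ∨
      (i % 2 = 1 ∧ j % 2 = 1) := by
    rcases Int.emod_two_eq_zero_or_one i with hi | hi <;>
      rcases Int.emod_two_eq_zero_or_one j with hj | hj
    · exact Or.inl (mid hij h00 (by omega) (by omega))
    · exact Or.inr (Or.inr (Or.inl (mid hij h01 (by omega) (by omega))))
    · exact Or.inr (Or.inl (mid hij h10 (by omega) (by omega)))
    · exact Or.inr (Or.inr (Or.inr ⟨hi, hj⟩))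
  by_cases hd : ∃ i j, S i j ∧ i % 2 = 1 ∧ j % 2 = 1
  · obtain ⟨i, j, hij, hi, hj⟩ := hd
    have hS (p q : ℤ) : S p q ↔ (p = 0 ∧ q = 0) ∨ (p = 1 ∧ q = 0) ∨ (p = 0 ∧ q = 1) ∨
        (p = i ∧ q = j) := by
      constructor
      · intro hpq
        rcases odd hpq with e | e | e | ⟨e₁, e₂⟩
        · exact Or.inl e
        · exact Or.inr (Or.inl e)
        · exact Or.inr (Or.inr (Or.inl e))
        · exact Or.inr (Or.inr (Or.inr (mid hpq hij (by omega) (by omega))))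
      · rintro (⟨rfl, rfl⟩ | ⟨rfl, rfl⟩ | ⟨rfl, rfl⟩ | ⟨rfl, rfl⟩) <;> assumption
    have bot : 0 ≤ j ∨ j = -1 := by
      by_contra hcon
      obtain ⟨s, hs⟩ := h.exists_level_one' 0 0 1 0 0 (-1) (D := -1) (by ring) (by norm_num) h00
        (by simpa using h10) (i := i) (j := -j) (by omega)
        (eq_of_eq_of_eq hij (by ring) (by ring))
      have := (hS _ _).1 hs
      omega
    have left : 0 ≤ i ∨ i = -1 := by
      by_contra hcon
      obtain ⟨s, hs⟩ := h.exists_level_one' 0 0 0 1 (-1) 0 (D := 1) (by ring) (by norm_num) h00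
        (by simpa using h01) (i := j) (j := -i) (by omega)
        (eq_of_eq_of_eq hij (by ring) (by ring))
      have := (hS _ _).1 hs
      omega
    have diag : i + j ≤ 1 ∨ i + j = 2 := by
      by_contra hcon
      obtain ⟨s, hs⟩ := h.exists_level_one' 1 0 (-1) 1 1 0 (D := -1) (by ring) (by norm_num) h10
        (by simpa using h01) (i := j) (j := i + j - 1) (by omega)
        (eq_of_eq_of_eq hij (by ring) (by ring))
      have := (hS _ _).1 hs
      omega
    have : (i = 1 ∧ j = 1) ∨ (i = 1 ∧ j = -1) ∨ (i = -1 ∧ j = 1) ∨ (i = -1 ∧ j = -1) ∨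
        (i = 3 ∧ j = -1) ∨ (i = -1 ∧ j = 3) := by omega
    rcases this with ⟨rfl, rfl⟩ | ⟨rfl, rfl⟩ | ⟨rfl, rfl⟩ | ⟨rfl, rfl⟩ | ⟨rfl, rfl⟩ | ⟨rfl, rfl⟩
    · exact (h.no_parallelogram hn h00 h10 h01 hij).elim
    · exact ((h.pull 0 1 1 (-1) 0 0 (D := -1) (by ring) (by norm_num)).no_parallelogram hn
        (pull_mk h00 (by ring) (by ring)) (pull_mk h01 (by ring) (by ring))
        (pull_mk hij (by ring) (by ring)) (pull_mk h10 (by ring) (by ring))).elim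
    · exact ((h.pull 1 (-1) 0 1 0 0 (D := 1) (by ring) (by norm_num)).no_parallelogram hn
        (pull_mk h00 (by ring) (by ring)) (pull_mk h10 (by ring) (by ring))
        (pull_mk hij (by ring) (by ring)) (pull_mk h01 (by ring) (by ring))).elim
    · exact h.classified_of_centred hn hS
    · refine Classified.of_pull (-1) 2 1 (-1) 1 0 (D := -1) (by ring) (by norm_num) ?_
      refine (h.pull (-1) 2 1 (-1) 1 0 (D := -1) (by ring) (by norm_num)).classified_of_centred hn
        fun p q => ?_
      unfold _root_.pull
      rw [hS]
      omega
    · refine Classified.of_pull 1 (-1) (-1) 2 0 1 (D := 1) (by ring) (by norm_num) ?_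
      refine (h.pull 1 (-1) (-1) 2 0 1 (D := 1) (by ring) (by norm_num)).classified_of_centred hn
        fun p q => ?_
      unfold _root_.pull
      rw [hS]
      omega
  · have hS (p q : ℤ) : S p q ↔ (p = 0 ∧ q = 0) ∨ (p = 1 ∧ q = 0) ∨ (p = 0 ∧ q = 1) := by
      constructor
      · intro hpq
        rcases odd hpq with e | e | e | e
        · exact Or.inl e
        · exact Or.inr (Or.inl e)
        · exact Or.inr (Or.inr e)
        · exact (hd ⟨p, q, hpq, e⟩).elim
      · rintro (⟨rfl, rfl⟩ | ⟨rfl, rfl⟩ | ⟨rfl, rfl⟩) <;> assumption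
    rcases h.white hn h00 h10 h01 with w | w | w
    · refine Classified.of_pull 1 (-1) 0 1 0 0 (D := 1) (by ring) (by norm_num) ?_
      refine (h.pull 1 (-1) 0 1 0 0 (D := 1) (by ring) (by norm_num)).classified_triangle hn
        (m := 1) le_rfl (dvd_comb 1 0 0 _ w w w (by ring)) fun p q => ?_
      unfold _root_.pull
      rw [hS]
      omega
    · refine Classified.of_pull (-1) 0 0 1 1 0 (D := -1) (by ring) (by norm_num) ?_
      refine (h.pull (-1) 0 0 1 1 0 (D := -1) (by ring) (by norm_num)).classified_triangle hn
        (m := 1) le_rfl (dvd_comb (-1) 0 0 _ w w w (by ring)) fun p q => ?_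
      unfold _root_.pull
      rw [hS]
      omega
    · refine Classified.of_pull 0 1 (-1) 0 0 1 (D := 1) (by ring) (by norm_num) ?_
      refine (h.pull 0 1 (-1) 0 0 1 (D := 1) (by ring) (by norm_num)).classified_triangle hn
        (m := 1) le_rfl (dvd_comb (-1) 0 0 _ w w w (by ring)) fun p q => ?_
      unfold _root_.pull
      rw [hS]
      omega

theorem classified_of_unit_segment (h : IsConf n x y S V) (hn : 2 ≤ n)
    (hT : ∀ p q u₁ u₂, (u₁ ≠ 0 ∨ u₂ ≠ 0) → S (p - u₁) (q - u₂) → S p q → S (p + u₁) (q + u₂) →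
      False) (h00 : S 0 0) (h10 : S 1 0) {i j : ℤ} (hij : S i j) (hj : 1 ≤ j) :
    Classified n x y V := by
  obtain ⟨s, hs⟩ := h.exists_level_one h00 h10 hj hij
  refine Classified.of_pull 1 s 0 1 0 0 (D := 1) (by ring) (by norm_num) ?_
  refine (h.pull 1 s 0 1 0 0 (D := 1) (by ring) (by norm_num)).classified_of_unimodular_triangle hn
    (fun p q u₁ u₂ hu h₁ h₂ h₃ => ?_) (pull_mk h00 (by ring) (by ring))
    (pull_mk h10 (by ring) (by ring)) (pull_mk hs (by ring) (by ring))
  exact hT (p + s * q) q (u₁ + s * u₂) u₂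
    (by
      by_contra hcon
      push Not at hcon
      obtain ⟨e₁, rfl⟩ := hcon
      rw [mul_zero, add_zero] at e₁
      simp [e₁] at hu)
    (of_pull h₁ (by ring) (by ring)) (of_pull h₂ (by ring) (by ring))
    (of_pull h₃ (by ring) (by ring))

theorem exists_primitive {u₁ u₂ : ℤ} (hu : u₁ ≠ 0 ∨ u₂ ≠ 0) :
    ∃ g v₁ v₂ a b : ℤ, 0 < g ∧ u₁ = g * v₁ ∧ u₂ = g * v₂ ∧ v₁ * a + v₂ * b = 1 := by
  have hg : 0 < Int.gcd u₁ u₂ := by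
    rw [Int.gcd_pos_iff]
    exact hu
  obtain ⟨g, v₁, v₂, hg0, hco, e₁, e₂⟩ := Int.exists_gcd_one' hg
  obtain ⟨a, b, hab⟩ := Int.isCoprime_iff_gcd_eq_one.2 hco
  exact ⟨g, v₁, v₂, a, b, by exact_mod_cast hg0, by linarith, by linarith, by linarith⟩

/-- The classification, for the planar data of a polygon. -/
theorem classified (h : IsConf n x y S V) (hn : 2 ≤ n) : Classified n x y V := by
  by_cases hT : ∃ p q u₁ u₂, (u₁ ≠ 0 ∨ u₂ ≠ 0) ∧ S (p - u₁) (q - u₂) ∧ S p q ∧ S (p + u₁) (q + u₂)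
  · obtain ⟨p, q, u₁, u₂, hu, h₁, h₂, h₃⟩ := hT
    obtain ⟨g, v₁, v₂, a, b, hg, rfl, rfl, hab⟩ := exists_primitive hu
    refine Classified.of_pull v₁ (-b) v₂ a p q (D := 1) (by linear_combination hab)
      (by norm_num) ?_
    refine (h.pull v₁ (-b) v₂ a p q (D := 1) (by linear_combination hab)
      (by norm_num)).classified_of_collinear hn
      (pull_mk (h.seg h₂ h₁ (l := g - 1) (m := 1) (p := p - v₁) (q := q - v₂) (by linarith)
        (by norm_num) (by linarith) (by ring) (by ring)) (by ring) (by ring))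
      (pull_mk h₂ (by ring) (by ring))
      (pull_mk (h.seg h₂ h₃ (l := g - 1) (m := 1) (p := p + v₁) (q := q + v₂) (by linarith)
        (by norm_num) (by linarith) (by ring) (by ring)) (by ring) (by ring))
  · have hT' (p q u₁ u₂ : ℤ) (hu : u₁ ≠ 0 ∨ u₂ ≠ 0) (h₁ : S (p - u₁) (q - u₂)) (h₂ : S p q)
        (h₃ : S (p + u₁) (q + u₂)) : False := hT ⟨p, q, u₁, u₂, hu, h₁, h₂, h₃⟩
    obtain ⟨p, q, hpq, -⟩ := h.nondeg 1 0 0 (by norm_num)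
    obtain ⟨p', q', hpq', hne⟩ := h.nondeg 1 0 p (by norm_num)
    obtain ⟨g, v₁, v₂, a, b, hg, e₁, e₂, hab⟩ := exists_primitive (u₁ := p' - p) (u₂ := q' - q)
      (Or.inl fun e => hne (by linarith))
    have hv : S (p + v₁) (q + v₂) := h.seg hpq hpq' (l := g - 1) (m := 1) (by linarith)
      (by norm_num) (by linarith) (by linear_combination e₁) (by linear_combination e₂)
    obtain ⟨i, j, hij, hne'⟩ := h.nondeg (-v₂) v₁ (v₁ * q - v₂ * p) (by
      by_contra hcon
      push Not at hcon
      obtain ⟨z₁, z₂⟩ := hcon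
      rw [neg_eq_zero] at z₁
      simp [z₁, z₂] at hab)
    have main (D : ℤ) (hD : D = 1 ∨ D = -1)
        (hj : 1 ≤ D * (v₁ * (j - q) - v₂ * (i - p))) : Classified n x y V := by
      have hDD : D * D = 1 := by rcases hD with rfl | rfl <;> norm_num
      have hdet : v₁ * (D * a) - (-(D * b)) * v₂ = D := by linear_combination D * hab
      refine Classified.of_pull v₁ (-(D * b)) v₂ (D * a) p q hdet hDD ?_
      refine (h.pull v₁ (-(D * b)) v₂ (D * a) p q hdet hDD).classified_of_unit_segment hn
        (fun p' q' u₁ u₂ hu h₁ h₂ h₃ => ?_) (pull_mk hpq (by ring) (by ring))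
        (pull_mk hv (by ring) (by ring)) (i := a * (i - p) + b * (j - q))
        (j := D * (v₁ * (j - q) - v₂ * (i - p))) (pull_mk hij ?_ ?_) hj
      · exact hT' (v₁ * p' + -(D * b) * q' + p) (v₂ * p' + D * a * q' + q)
          (v₁ * u₁ + -(D * b) * u₂) (v₂ * u₁ + D * a * u₂)
          (by
            by_contra hcon
            push Not at hcon
            obtain ⟨z₁, z₂⟩ := eq_of_unimodular hdet hDD hcon.1 hcon.2
            tauto)
          (of_pull h₁ (by ring) (by ring)) (of_pull h₂ (by ring) (by ring))
          (of_pull h₃ (by ring) (by ring))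
      · linear_combination (-(i - p)) * hab + b * (v₁ * (j - q) - v₂ * (i - p)) * hDD
      · linear_combination (-(j - q)) * hab - a * (v₁ * (j - q) - v₂ * (i - p)) * hDD
    rcases le_or_gt 1 (v₁ * (j - q) - v₂ * (i - p)) with h1 | h1
    · exact main 1 (Or.inl rfl) (by linarith)
    · refine main (-1) (Or.inr rfl) ?_
      have : v₁ * (j - q) - v₂ * (i - p) ≠ 0 := fun e => hne' (by linarith)
      omega

end IsConf

theorem convex_convexHull_diff {E : Type*} [AddCommGroup E] [Module ℚ E] {G : Set E} {p : E}
    (hpG : p ∈ G) (hp : p ∉ convexHull ℚ (G \ {p})) : Convex ℚ (convexHull ℚ G \ {p}) := by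
  have key {z : E} (hz : z ∈ convexHull ℚ G \ {p}) :
      ∃ t : ℚ, 0 < t ∧ ∃ c ∈ convexHull ℚ (G \ {p}), z = (1 - t) • p + t • c := by
    rcases (G \ {p}).eq_empty_or_nonempty with he | he
    · have : G ⊆ {p} := Set.sdiff_eq_empty.1 he
      have := convexHull_mono (𝕜 := ℚ) this hz.1
      rw [convexHull_singleton] at this
      exact (hz.2 this).elim
    · have h1 := hz.1
      rw [← Set.insert_eq_of_mem hpG, ← Set.insert_sdiff_singleton, convexHull_insert he,
        mem_convexJoin] at h1
      obtain ⟨a, ha, c, hc, u, t, hu, ht, hut, rfl⟩ := h1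
      rw [Set.mem_singleton_iff] at ha
      subst ha
      refine ⟨t, ht.lt_of_ne ?_, c, hc, by rw [← hut]; module⟩
      rintro rfl
      apply hz.2
      rw [add_zero] at hut
      simp [hut]
  rintro z₁ h₁ z₂ h₂ a b ha hb hab
  refine ⟨convex_convexHull ℚ G h₁.1 h₂.1 ha hb hab, fun heq => hp ?_⟩
  rw [Set.mem_singleton_iff] at heq
  obtain ⟨t₁, ht₁, c₁, hc₁, rfl⟩ := key h₁
  obtain ⟨t₂, ht₂, c₂, hc₂, rfl⟩ := key h₂
  have hs : 0 < a * t₁ + b * t₂ := by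
    rcases ha.eq_or_lt with rfl | ha'
    · have : b = 1 := by linarith
      subst this
      linarith
    · have := mul_pos ha' ht₁
      have := mul_nonneg hb ht₂.le
      linarith
  have e : p = (a * t₁ / (a * t₁ + b * t₂)) • c₁ + (b * t₂ / (a * t₁ + b * t₂)) • c₂ := by
    have e₁ : (a * t₁ + b * t₂) • p = (a * t₁) • c₁ + (b * t₂) • c₂ := by
      have h2 : (a * t₁ + b * t₂) • p = (a + b) • p -
          (a • ((1 - t₁) • p + t₁ • c₁) + b • ((1 - t₂) • p + t₂ • c₂)) +
          (a * t₁) • c₁ + (b * t₂) • c₂ := by module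
      rw [h2, heq, hab]
      module
    calc p = (a * t₁ + b * t₂)⁻¹ • (a * t₁ + b * t₂) • p := by
          rw [smul_smul, inv_mul_cancel₀ hs.ne', one_smul]
      _ = _ := by
          rw [e₁, smul_add, smul_smul, smul_smul]
          congr 2 <;> ring
  have hmem := convex_convexHull ℚ _ hc₁ hc₂ (div_nonneg (mul_nonneg ha ht₁.le) hs.le)
    (div_nonneg (mul_nonneg hb ht₂.le) hs.le) (by field_simp)
  rwa [← e] at hmem

theorem convex_three {E : Type*} [AddCommGroup E] [Module ℚ E] {K : Set E} (hK : Convex ℚ K)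
    {a b c : E} (ha : a ∈ K) (hb : b ∈ K) (hc : c ∈ K) {l m k : ℚ} (hl : 0 ≤ l) (hm : 0 ≤ m)
    (hk : 0 ≤ k) (hsum : l + m + k = 1) : l • a + m • b + k • c ∈ K := by
  have := hK.sum_mem (t := Finset.univ) (w := ![l, m, k]) (z := ![a, b, c])
    (fun i _ => by fin_cases i <;> simpa) (by simpa [Fin.sum_univ_three] using hsum)
    (fun i _ => by fin_cases i <;> simpa)
  simpa [Fin.sum_univ_three] using this

/-- An integral combination of three lattice points, scaled to a convex combination. -/
theorem exists_convex_combination {K : Set (Fin 3 → ℚ)} (hK : Convex ℚ K) {a b c : Fin 3 → ℤ}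
    (ha : castVec a ∈ K) (hb : castVec b ∈ K) (hc : castVec c ∈ K) {l m k : ℤ} (hl : 0 ≤ l)
    (hm : 0 ≤ m) (hk : 0 ≤ k) (hpos : 0 < l + m + k) :
    ∃ z ∈ K, ∀ j, ((l + m + k : ℤ) : ℚ) * z j = (l * a j + m * b j + k * c j : ℤ) := by
  have hs : (0 : ℚ) < l + m + k := by exact_mod_cast hpos
  have hl' : (0 : ℚ) ≤ l := by exact_mod_cast hl
  have hm' : (0 : ℚ) ≤ m := by exact_mod_cast hm
  have hk' : (0 : ℚ) ≤ k := by exact_mod_cast hk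
  refine ⟨_, convex_three hK ha hb hc (l := l / (l + m + k)) (m := m / (l + m + k))
    (k := k / (l + m + k)) (div_nonneg hl' hs.le) (div_nonneg hm' hs.le) (div_nonneg hk' hs.le)
    (by field_simp), fun j => ?_⟩
  simp only [Pi.add_apply, Pi.smul_apply, smul_eq_mul, castVec]
  push_cast
  field_simp

theorem castVec_injective : Function.Injective castVec := fun p q h => by
  ext j
  have := congrFun h j
  simp only [castVec] at this
  exact_mod_cast this

theorem le_of_mem_convexHull {r : ℕ} {w : Fin r → Fin 3 → ℤ} {z : Fin 3 → ℚ}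
    (hz : z ∈ convexHull ℚ (Set.range fun k => castVec (w k))) (g₁ g₂ c : ℤ)
    (h : ∀ k, c ≤ g₁ * w k 0 + g₂ * w k 1) : (c : ℚ) ≤ g₁ * z 0 + g₂ * z 1 := by
  have hconv : Convex ℚ {z : Fin 3 → ℚ | (c : ℚ) ≤ g₁ * z 0 + g₂ * z 1} := by
    intro a ha b hb s t hs ht hst
    simp only [Set.mem_ofPred_eq, Pi.add_apply, Pi.smul_apply, smul_eq_mul] at ha hb ⊢
    have := mul_le_mul_of_nonneg_left ha hs
    have := mul_le_mul_of_nonneg_left hb ht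
    have e : (c : ℚ) = s * c + t * c := by rw [← add_mul, hst, one_mul]
    linarith
  refine convexHull_min ?_ hconv hz
  rintro _ ⟨k, rfl⟩
  have := h k
  simp only [Set.mem_ofPred_eq, castVec]
  exact_mod_cast this

/-- The planar data of a lattice polygon at height `n`. -/
theorem isConf_of_vertices {r : ℕ} {n : ℤ} (hn : 0 < n) (w : Fin r → Fin 3 → ℤ)
    (hw : ∀ k, w k 2 = n)
    (hv : ∀ k, castVec (w k) ∉
      convexHull ℚ ((Set.range fun k => castVec (w k)) \ {castVec (w k)}))
    (hnd : ∀ g₁ g₂ c : ℤ, (g₁ ≠ 0 ∨ g₂ ≠ 0) → ∃ k, g₁ * w k 0 + g₂ * w k 1 ≠ c)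
    (hcan : ∀ (p : Fin 3 → ℤ) (h : ℤ), 0 < h → h < n → p 2 = h →
      ∀ z ∈ convexHull ℚ (Set.range fun k => castVec (w k)),
      castVec p ≠ ((h : ℚ) / n) • z) :
    IsConf n 0 0
      (fun i j => castVec ![i, j, n] ∈ convexHull ℚ (Set.range fun k => castVec (w k)))
      (fun i j => ∃ k, w k = ![i, j, n]) where
  sub := by
    rintro i j ⟨k, hk⟩
    rw [← hk]
    exact subset_convexHull _ _ ⟨k, rfl⟩
  closed a₁ a₂ b₁ b₂ c₁ c₂ l m k p q ha hb hc hl hm hk hpos e₁ e₂ := by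
    obtain ⟨z, hz, hz'⟩ := exists_convex_combination (convex_convexHull ℚ _) ha hb hc hl hm hk hpos
    have hs : ((l + m + k : ℤ) : ℚ) ≠ 0 := by exact_mod_cast hpos.ne'
    convert hz using 1
    ext j
    apply mul_left_cancel₀ hs
    rw [hz']
    simp only [castVec]
    norm_cast
    fin_cases j
    · simpa using e₁.symm
    · simpa using e₂.symm
    · simp; ring
  supp g₁ g₂ c hV i j hS := by
    have := le_of_mem_convexHull hS g₁ g₂ c fun k => hV _ _ ⟨k, by
      ext j
      fin_cases j
      · rfl
      · rfl
      · exact hw k⟩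
    simp only [castVec] at this
    exact_mod_cast this
  ext a₁ a₂ b₁ b₂ c₁ c₂ l m k p q ha hb hc hl hm hk hpos e₁ e₂ hpq := by
    obtain ⟨t, ht⟩ := hpq
    by_contra hcon
    push Not at hcon
    have hD := convex_convexHull_diff (Set.mem_range_self t) (hv t)
    have ne {u₁ u₂ : ℤ} (hne : u₁ = p → u₂ ≠ q) : castVec ![u₁, u₂, n] ≠ castVec (w t) := by
      intro heq
      have := castVec_injective heq
      rw [ht] at this
      exact hne (by simpa using congrFun this 0) (by simpa using congrFun this 1)
    obtain ⟨z, hz, hz'⟩ := exists_convex_combination hD ⟨ha, ne hcon.1⟩ ⟨hb, ne hcon.2.1⟩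
      ⟨hc, ne hcon.2.2⟩ hl hm hk hpos
    have hs : ((l + m + k : ℤ) : ℚ) ≠ 0 := by exact_mod_cast hpos.ne'
    refine hz.2 ?_
    rw [Set.mem_singleton_iff]
    ext j
    apply mul_left_cancel₀ hs
    rw [hz', ht]
    simp only [castVec]
    norm_cast
    fin_cases j
    · simpa using e₁
    · simpa using e₂
    · simp; ring
  nondeg g₁ g₂ c hg := by
    obtain ⟨k, hk⟩ := hnd g₁ g₂ c hg
    refine ⟨w k 0, w k 1, subset_convexHull _ _ ⟨k, ?_⟩, hk⟩
    change castVec (w k) = castVec _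
    congr 1
    ext j
    fin_cases j
    · rfl
    · rfl
    · exact hw k
  bdd g₁ g₂ := by
    obtain ⟨B, hB⟩ := (Set.finite_range fun k => g₁ * w k 0 + g₂ * w k 1).bddAbove
    refine ⟨B, fun i j hS => ?_⟩
    have := le_of_mem_convexHull hS (-g₁) (-g₂) (-B) fun k => by
      have := hB ⟨k, rfl⟩
      linarith
    simp only [castVec] at this
    have h2 : -B ≤ -g₁ * i + -g₂ * j := by exact_mod_cast this
    linarith
  canon h a₁ a₂ b₁ b₂ c₁ c₂ l m k p q hh hhn ha hb hc hl hm hk hpos e₁ e₂ := by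
    obtain ⟨z, hz, hz'⟩ := exists_convex_combination (convex_convexHull ℚ _) ha hb hc hl hm hk hpos
    refine hcan ![p, q, h] h hh hhn rfl z hz ?_
    have hs : ((l + m + k : ℤ) : ℚ) ≠ 0 := by exact_mod_cast hpos.ne'
    have hn' : (n : ℚ) ≠ 0 := by exact_mod_cast hn.ne'
    ext j
    apply mul_left_cancel₀ hs
    simp only [Pi.smul_apply, smul_eq_mul, castVec]
    rw [show ((l + m + k : ℤ) : ℚ) * (h / n * z j) = h / n * (((l + m + k : ℤ) : ℚ) * z j) by ring,
      hz', div_mul_eq_mul_div, eq_div_iff hn']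
    norm_cast
    fin_cases j
    · simp only [zero_add] at e₁
      simp only [Fin.zero_eta, Matrix.cons_val_zero]
      linear_combination -e₁
    · simp only [zero_add] at e₂
      simp only [Fin.mk_one, Matrix.cons_val_one, Matrix.cons_val_zero]
      linear_combination -e₂
    · simp
      ring

theorem exists_unimodular_of_primitive (α : Fin 3 → ℤ)
    (hα : ∀ d : ℤ, 0 < d → (∀ j, d ∣ α j) → d = 1) :
    ∃ M : Matrix (Fin 3) (Fin 3) ℤ, M.det = 1 ∧ M 2 = α := by
  by_cases h : α 0 ≠ 0 ∨ α 1 ≠ 0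
  · obtain ⟨g, a, b, s, t, hg, ha, hb, hab⟩ := IsConf.exists_primitive h
    have hgc : Int.gcd g (α 2) = 1 := by
      have hpos : 0 < Int.gcd g (α 2) := Int.gcd_pos_of_ne_zero_left _ hg.ne'
      have h₁ := Int.gcd_dvd_left g (α 2)
      have h₂ := Int.gcd_dvd_right g (α 2)
      have := hα (Int.gcd g (α 2)) (by exact_mod_cast hpos) fun j => by
        fin_cases j
        · exact ha ▸ h₁.mul_right a
        · exact hb ▸ h₁.mul_right b
        · exact h₂
      exact_mod_cast this
    obtain ⟨y, x, hxy⟩ := Int.isCoprime_iff_gcd_eq_one.2 hgc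
    refine ⟨!![-t, s, 0; -x * a, -x * b, y; g * a, g * b, α 2], ?_, ?_⟩
    · rw [Matrix.det_fin_three]
      simp only [Matrix.of_apply, Matrix.cons_val]
      linear_combination (y * g + x * α 2) * hab + hxy
    · ext j
      fin_cases j
      · exact ha.symm
      · exact hb.symm
      · rfl
  · push Not at h
    have hc : α 2 * α 2 = 1 := by
      have h0 : α 2 ≠ 0 := fun h2 => by
        have := hα 2 (by norm_num) fun j => by
          fin_cases j <;> simp [h.1, h.2, h2]
        norm_num at this
      have := hα |α 2| (abs_pos.2 h0) fun j => by
        fin_cases j <;> simp [h.1, h.2]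
      rw [← abs_mul_abs_self, this, one_mul]
    refine ⟨!![1, 0, 0; 0, α 2, 0; 0, 0, α 2], ?_, ?_⟩
    · rw [Matrix.det_fin_three]
      simpa using hc
    · ext j
      fin_cases j
      · exact h.1.symm
      · exact h.2.symm
      · rfl

theorem castVec_mulVec (A : Matrix (Fin 3) (Fin 3) ℤ) (p : Fin 3 → ℤ) :
    castVec (A.mulVec p) = (A.map fun x : ℤ => (x : ℚ)).mulVecLin (castVec p) := by
  ext j
  simp [castVec, Matrix.mulVec, dotProduct, Fin.sum_univ_three]

theorem eq_zero_of_dotProduct_eq_zero {r : ℕ} {v : Fin r → Fin 3 → ℤ}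
    (hfull : affineSpan ℚ (gens v) = ⊤) {β : Fin 3 → ℤ} (h : ∀ k, dotProduct β (v k) = 0) :
    β = 0 := by
  let F : (Fin 3 → ℚ) →ₗ[ℚ] ℚ := dotProductBilin ℚ ℚ (castVec β)
  have hF : affineSpan ℚ (gens v) ≤ (LinearMap.ker F).toAffineSubspace := by
    refine affineSpan_le.2 ?_
    rintro _ (rfl | ⟨k, rfl⟩)
    · exact (LinearMap.ker F).zero_mem
    · have := h k
      simp only [dotProduct] at this
      change dotProduct (castVec β) (castVec (v k)) = 0
      simp only [dotProduct, castVec]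
      exact_mod_cast this
  rw [hfull] at hF
  have hz (z : Fin 3 → ℚ) : dotProduct (castVec β) z = 0 := hF (AffineSubspace.mem_top ℚ _ z)
  have := dotProduct_eq_zero _ hz
  ext j
  have := congrFun this j
  simp only [castVec, Pi.zero_apply] at this
  exact_mod_cast this

/-- In coordinates adapted to `α`, a canonical polytope gives planar data at height `ι`. -/
theorem isConf_of_canonical {r : ℕ} {v : Fin r → Fin 3 → ℤ} {ι : ℤ} (hι : 0 < ι)
    (hfull : affineSpan ℚ (gens v) = ⊤)
    (hvert : ∀ p ∈ gens v, p ∉ convexHull ℚ (gens v \ {p}))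
    {M : Matrix (Fin 3) (Fin 3) ℤ} (hM : M.det = 1)
    (hα : ∀ i, dotProduct (M 2) (v i) = ι)
    (hcan : ∀ p : Fin 3 → ℤ, castVec p ∈ hullP v → p ≠ 0 → dotProduct (M 2) p = ι) :
    ∃ S, IsConf ι 0 0 S fun i j => ∃ k, M.mulVec (v k) = ![i, j, ι] := by
  have hNM : M.adjugate * M = 1 := by rw [Matrix.adjugate_mul, hM, one_smul]
  have hMN : M * M.adjugate = 1 := by rw [Matrix.mul_adjugate, hM, one_smul]
  generalize M.adjugate = N at hNM hMN
  have hN (q : Fin 3 → ℤ) : N.mulVec (M.mulVec q) = q := by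
    rw [Matrix.mulVec_mulVec, hNM, Matrix.one_mulVec]
  have hmem {k : Fin 3 → ℚ} {T T' : Set (Fin 3 → ℚ)} {z : Fin 3 → ℚ}
      (hz : z ∈ convexHull ℚ T)
      (hT : ∀ y ∈ T, (N.map fun x : ℤ => (x : ℚ)).mulVecLin y ∈ T')
      (hk : k = (N.map fun x : ℤ => (x : ℚ)).mulVecLin z) :
      k ∈ convexHull ℚ T' := by
    have := Set.mem_image_of_mem (N.map fun x : ℤ => (x : ℚ)).mulVecLin hz
    rw [LinearMap.image_convexHull] at this
    rw [hk]
    exact convexHull_mono (Set.image_subset_iff.2 hT) this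
  refine ⟨_, isConf_of_vertices hι (fun k => M.mulVec (v k)) hα (fun k hk => ?_) ?_ ?_⟩
  · refine hvert _ (Or.inr ⟨k, rfl⟩) (hmem hk ?_ (by rw [← castVec_mulVec, hN]))
    rintro _ ⟨⟨i, rfl⟩, hi⟩
    simp only [← castVec_mulVec, hN]
    refine ⟨Or.inr ⟨i, rfl⟩, fun heq => hi ?_⟩
    rw [Set.mem_singleton_iff] at heq ⊢
    simp only [castVec_mulVec, heq]
  · intro g₁ g₂ c hg
    by_contra! hcon
    have h0 : Matrix.vecMul ![ι * g₁, ι * g₂, -c] M = 0 := by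
      refine eq_zero_of_dotProduct_eq_zero hfull fun k => ?_
      rw [← Matrix.dotProduct_mulVec]
      have h1 := hcon k
      have h2 : M.mulVec (v k) 2 = ι := hα k
      simp only [dotProduct, Fin.sum_univ_three, Matrix.cons_val]
      rw [h2]
      linear_combination ι * h1
    have h1 : ![ι * g₁, ι * g₂, -c] = 0 := by
      rw [← Matrix.vecMul_one ![ι * g₁, ι * g₂, -c], ← hMN, ← Matrix.vecMul_vecMul, h0,
        Matrix.zero_vecMul]
    have h2 : ι * g₁ = 0 := congrFun h1 0
    have h3 : ι * g₂ = 0 := congrFun h1 1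
    simp only [mul_eq_zero, hι.ne', false_or] at h2 h3
    tauto
  · intro p h hh hhn hp z hz heq
    have hα' (q : Fin 3 → ℤ) : dotProduct (M 2) (N.mulVec q) = q 2 := by
      change M.mulVec (N.mulVec q) 2 = q 2
      rw [Matrix.mulVec_mulVec, hMN, Matrix.one_mulVec]
    have hz' : (N.map fun x : ℤ => (x : ℚ)).mulVecLin z ∈ hullP v := by
      refine hmem hz ?_ rfl
      rintro _ ⟨i, rfl⟩
      simp only [← castVec_mulVec, hN]
      exact Or.inr ⟨i, rfl⟩
    have h0 : (0 : Fin 3 → ℚ) ∈ hullP v := subset_convexHull _ _ (Or.inl rfl)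
    have hι' : (0 : ℚ) < ι := by exact_mod_cast hι
    have hh' : (0 : ℚ) < h := by exact_mod_cast hh
    have hhn' : (h : ℚ) < ι := by exact_mod_cast hhn
    have := hcan (N.mulVec p) (by
      rw [castVec_mulVec, heq, map_smul]
      exact (convex_convexHull ℚ _).smul_mem_of_zero_mem h0 hz'
        ⟨(div_pos hh' hι').le, (div_le_one hι').2 hhn'.le⟩) fun h1 => by
      have := hα' p
      rw [h1, dotProduct_zero] at this
      omega
    rw [hα', hp] at this
    omega

/-- An equivalence of planar data lifts to a lattice equivalence of polytopes. -/
theorem Img.latticeEquiv {r : ℕ} {v : Fin r → Fin 3 → ℤ} {ι : ℤ}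
    (hdist : Function.Injective v) {M : Matrix (Fin 3) (Fin 3) ℤ} (hM : M.det = 1)
    (hα : ∀ i, dotProduct (M 2) (v i) = ι) {E : Set (ℤ × ℤ)}
    (hE : Img ι 0 0 (fun i j => ∃ k, M.mulVec (v k) = ![i, j, ι]) E) :
    r = E.ncard ∧ LatticeEquiv3 (hullP v)
      (convexHull ℚ (insert 0 ((fun e : ℤ × ℤ => castVec ![e.1, e.2, ι]) '' E))) := by
  obtain ⟨a, b, c, d, k, l, hdet, hE⟩ := hE
  have hAdet : (!![a, b, k; c, d, l; 0, 0, 1] * M).det = a * d - b * c := by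
    rw [Matrix.det_mul, hM, Matrix.det_fin_three]
    simp
  set A := !![a, b, k; c, d, l; 0, 0, 1] * M with hA
  have hinj : Function.Injective fun i => A.mulVec (v i) := by
    refine (Matrix.mulVec_injective_of_isUnit ?_).comp hdist
    rw [Matrix.isUnit_iff_isUnit_det, hAdet, Int.isUnit_iff]
    exact hdet
  let e (i : Fin r) : ℤ × ℤ := (A.mulVec (v i) 0, A.mulVec (v i) 1)
  have he (i : Fin r) : A.mulVec (v i) = ![(e i).1, (e i).2, ι] := by
    ext j
    fin_cases j
    · rfl
    · rfl
    · change A.mulVec (v i) 2 = ι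
      rw [← hα i, hA, ← Matrix.mulVec_mulVec]
      simp [Matrix.mulVec, dotProduct, Fin.sum_univ_three]
  have hEe : E = Set.range e := by
    have hev (i : Fin r) (z : Fin 3 → ℤ) (hz : M.mulVec (v i) = z) :
        e i = (a * z 0 + b * z 1 + k * z 2, c * z 0 + d * z 1 + l * z 2) := by
      simp only [e, hA, ← Matrix.mulVec_mulVec, hz]
      simp [Matrix.mulVec, dotProduct, Fin.sum_univ_three]
    ext ⟨p, q⟩
    rw [hE]
    constructor
    · rintro ⟨i, j, ⟨t, ht⟩, rfl, rfl⟩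
      refine ⟨t, ?_⟩
      rw [hev t _ ht]
      simp [mul_comm ι]
    · rintro ⟨t, ht⟩
      have ht' : M.mulVec (v t) 2 = ι := hα t
      rw [hev t _ rfl, ht', Prod.mk.injEq] at ht
      refine ⟨M.mulVec (v t) 0, M.mulVec (v t) 1, ⟨t, ?_⟩, ?_, ?_⟩
      · ext j
        fin_cases j
        · rfl
        · rfl
        · exact ht'
      · rw [← ht.1]; ring
      · rw [← ht.2]; ring
  refine ⟨?_, A, by rwa [hAdet], 0, ?_⟩
  · rw [hEe, Set.ncard_range_of_injective, Nat.card_fin]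
    intro i j hij
    apply hinj
    simp only [he, hij]
  · have h1 : (fun p => (A.map (fun x : ℤ => (x : ℚ))).mulVec p + castVec 0) =
        (A.map fun x : ℤ => (x : ℚ)).mulVecLin := by
      ext p j
      simp [castVec]
    rw [h1, hullP, LinearMap.image_convexHull, gens, Set.image_insert_eq, map_zero, hEe,
      ← Set.range_comp, ← Set.range_comp]
    congr 3
    ext i
    simp only [Function.comp_apply, ← castVec_mulVec, he]

/-- Ishida–Iwashita classification of ℚ-Gorenstein canonical lattice polytopes
`P = conv(0, v₁, …, v_r) ⊆ ℚ³` of index `ι`, up to lattice equivalence. -/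
theorem canonical_lattice_polytope_classification
    (r : ℕ) (hr : 3 ≤ r) (v : Fin r → Fin 3 → ℤ) (ι : ℤ) (hι : 1 ≤ ι)
    (hne : ∀ i, v i ≠ 0)
    (hdist : ∀ i j, i ≠ j → v i ≠ v j)
    (hfull : affineSpan ℚ (gens v) = ⊤)
    (hvert : ∀ p ∈ gens v, p ∉ convexHull ℚ (gens v \ {p}))
    (α : Fin 3 → ℤ)
    (hα : ∀ i, ∑ j, α j * v i j = ι)
    (hmin : ∀ ι' : ℤ, 0 < ι' → ι' < ι →
      ¬ ∃ β : Fin 3 → ℤ, ∀ i, ∑ j, β j * v i j = ι')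
    (hcan : ∀ p : Fin 3 → ℤ, castVec p ∈ hullP v → p ≠ 0 → ∑ j, α j * p j = ι) :
    -- Case (i)
    ι = 1 ∨
    -- Case (ii)
    (r = 4 ∧ ι = 2 ∧ ∃ m n : ℤ, 1 ≤ m ∧ 1 ≤ n ∧
      LatticeEquiv3 (hullP v)
        (convexHull ℚ ({0, ![1, 0, 2], ![1 + (m : ℚ), 1, 2], ![1, 2, 2],
          ![1 - (n : ℚ), 1, 2]} : Set (Fin 3 → ℚ)))) ∨
    -- Case (iii)
    (r = 3 ∧ 2 ≤ ι ∧ ∃ m n : ℤ, 1 ≤ m ∧ 1 ≤ n ∧ Int.gcd n ι = 1 ∧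
      LatticeEquiv3 (hullP v)
        (convexHull ℚ ({0, ![1, (n : ℚ), (ι : ℚ)], ![0, (n : ℚ), (ι : ℚ)],
          ![1, (n : ℚ) + (m : ℚ), (ι : ℚ)]} : Set (Fin 3 → ℚ)))) ∨
    -- Case (iv)
    (r = 3 ∧ ι = 2 ∧ ∃ m : ℤ, 2 ≤ m ∧
      LatticeEquiv3 (hullP v)
        (convexHull ℚ ({0, ![1, 1, 2], ![0, 1, 2],
          ![2, 1 + 2 * (m : ℚ), 2]} : Set (Fin 3 → ℚ)))) ∨
    -- Case (v)
    (r = 3 ∧ ι = 2 ∧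
      LatticeEquiv3 (hullP v)
        (convexHull ℚ ({0, ![1, -2, 2], ![-1, -1, 2],
          ![2, 1, 2]} : Set (Fin 3 → ℚ)))) ∨
    -- Case (vi)
    (r = 3 ∧ ι = 3 ∧
      LatticeEquiv3 (hullP v)
        (convexHull ℚ ({0, ![1, -1, 3], ![0, -1, 3],
          ![2, 2, 3]} : Set (Fin 3 → ℚ)))) := by
  rcases hι.eq_or_lt with h1 | h1
  · exact Or.inl h1.symm
  have hprim (d : ℤ) (hd : 0 < d) (hdvd : ∀ j, d ∣ α j) : d = 1 := by
    by_contra hd1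
    choose β hβ using hdvd
    have hι' (i : Fin r) : d * ∑ j, β j * v i j = ι := by
      rw [← hα i, Finset.mul_sum]
      exact Finset.sum_congr rfl fun j _ => by rw [hβ, mul_assoc]
    have h0 := hι' ⟨0, by omega⟩
    set ι' := ∑ j, β j * v ⟨0, by omega⟩ j
    refine hmin ι' ?_ ?_ ⟨β, fun i => mul_left_cancel₀ hd.ne' ((hι' i).trans h0.symm)⟩
    · by_contra! hcon
      nlinarith
    · have : 0 < ι' := by
        by_contra! hcon
        nlinarith
      have : 2 ≤ d := by omega
      nlinarith
  obtain ⟨M, hM, rfl⟩ := exists_unimodular_of_primitive α hprim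
  obtain ⟨S, hS⟩ := isConf_of_canonical (by omega) hfull hvert hM hα hcan
  obtain ⟨E, hE, hImg⟩ := hS.classified h1
  obtain ⟨hrE, hL⟩ := hImg.latticeEquiv
    (fun i j hij => by_contra fun hne' => hdist i j hne' hij) hM hα
  right
  have hvec (a b c : ℤ) : castVec ![a, b, c] = ![(a : ℚ), b, c] := by
    ext j
    fin_cases j <;> rfl
  rcases hE with ⟨rfl, m, k, hm, hk, rfl⟩ | ⟨m, k, hm, hk, hg, rfl⟩ | ⟨rfl, m, hm, rfl⟩ |
    ⟨rfl, rfl⟩ | ⟨rfl, rfl⟩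
  · refine Or.inl ⟨?_, rfl, m, k, hm, hk, by simpa [Set.image_insert_eq, hvec] using hL⟩
    exact hrE.trans (Set.ncard_eq_four.2 ⟨_, _, _, _, by simp, by simp, by simp, by simp,
      by simp; omega, by simp, rfl⟩)
  · refine Or.inr <| Or.inl
      ⟨?_, h1, m, k, hm, hk, hg, by simpa [Set.image_insert_eq, hvec] using hL⟩
    exact hrE.trans (Set.ncard_eq_three.2 ⟨_, _, _, by simp, by simp; omega, by simp, rfl⟩)
  · refine Or.inr <| Or.inr <| Or.inl
      ⟨?_, rfl, m, hm, by simpa [Set.image_insert_eq, hvec] using hL⟩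
    exact hrE.trans (Set.ncard_eq_three.2 ⟨_, _, _, by simp, by simp, by simp, rfl⟩)
  · refine Or.inr <| Or.inr <| Or.inr <| Or.inl
      ⟨?_, rfl, by simpa [Set.image_insert_eq, hvec] using hL⟩
    exact hrE.trans (Set.ncard_eq_three.2 ⟨_, _, _, by simp, by simp, by simp, rfl⟩)
  · refine Or.inr <| Or.inr <| Or.inr <| Or.inr
      ⟨?_, rfl, by simpa [Set.image_insert_eq, hvec] using hL⟩
    exact hrE.trans (Set.ncard_eq_three.2 ⟨_, _, _, by simp, by simp, by simp, rfl⟩)
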